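/- arXiv:2501.11736 — 10 statements merged into one kernel-verified Lean document; each statement's English description precedes it below -/
import Mathlib

section
/- For every positive integer g, the limit lim_{n→∞} η_g(n)/√n exists and is a positive real number. -/
/-- `A` is a `g`-difference basis for `[n]`: for every integer `x` with `1 ≤ x ≤ n`
there are at least `g` ordered pairs `(a₁, a₂) ∈ A × A` with `a₁ - a₂ = x`. -/
def IsGDiffBasis (g n : ℕ) (A : Finset ℤ) : Prop :=
  ∀ x : ℤ, 1 ≤ x → x ≤ (n : ℤ) →
    g ≤ ((A ×ˢ A).filter (fun p => p.1 - p.2 = x)).card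

/-- `eta g n` is the smallest cardinality of a `g`-difference basis for `[n]`. -/
noncomputable def eta (g n : ℕ) : ℕ :=
  sInf {k | ∃ A : Finset ℤ, A.card = k ∧ IsGDiffBasis g n A}

/-- A plane in a cubic extension `F` of the finite field `K` of order `q` yields `q + 1` residues
modulo `q ^ 2 + q + 1` whose differences cover all residues (Singer's construction). -/
theorem exists_cyclic_difference_cover (K F : Type*) [Field K] [Fintype K] [Field F] [Finite F]
    [Algebra K F] (hfin : Module.finrank K F = 3) :
    ∃ D : Finset ℤ, D.card ≤ Fintype.card K + 1 ∧
      (∀ d ∈ D, 0 ≤ d ∧ d < (Fintype.card K : ℤ) ^ 2 + Fintype.card K + 1) ∧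
      ∀ x : ℤ, ∃ d ∈ D, ∃ d' ∈ D,
        ((Fintype.card K : ℤ) ^ 2 + Fintype.card K + 1) ∣ x - (d - d') := by
  classical
  have := Fintype.ofFinite F
  set q := Fintype.card K with hq
  set m : ℤ := (q : ℤ) ^ 2 + q + 1 with hm
  have hm0 : 0 < m := by positivity
  have hq1 : 1 < q := Fintype.one_lt_card
  obtain ⟨γ, hγ⟩ := IsCyclic.exists_generator (α := Fˣ)
  have hord : (orderOf γ : ℤ) = m * (q - 1) := by
    rw [orderOf_eq_card_of_forall_mem_zpowers hγ, Nat.card_units, Nat.card_eq_fintype_card,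
      Module.card_eq_pow_finrank (K := K) (V := F), hfin,
      Nat.cast_sub (Nat.one_le_pow _ _ (by lia))]
    push_cast
    ring
  have hlog : ∀ w : F, ∃ i : ℤ, w ≠ 0 → (γ : F) ^ i = w := by
    intro w
    by_cases hw : w = 0
    · exact ⟨0, fun h => absurd hw h⟩
    · obtain ⟨i, hi⟩ := hγ (Units.mk0 w hw)
      refine ⟨i, fun _ => ?_⟩
      simpa using congrArg (Units.val) hi
  choose ℓ hℓ using hlog
  have hscalar : ∀ (k : K) (i : ℤ), k ≠ 0 → (γ : F) ^ i = algebraMap K F k → m ∣ i := by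
    intro k i hk hi
    have h1 : γ ^ (i * ((q : ℤ) - 1)) = 1 := by
      apply Units.ext
      have h2 : k ^ (q - 1) = 1 := FiniteField.pow_card_sub_one_eq_one k hk
      have h3 : ((q : ℤ) - 1) = ((q - 1 : ℕ) : ℤ) := by push_cast [hq1.le]; ring
      rw [Units.val_zpow_eq_zpow_val, zpow_mul, hi, h3, zpow_natCast, ← map_pow, h2]
      simp
    have h4 := orderOf_dvd_iff_zpow_eq_one.mpr h1
    rw [hord] at h4
    exact Int.dvd_of_mul_dvd_mul_right (by lia) h4
  obtain ⟨θ, hθ⟩ : ∃ θ : F, θ ∉ Set.range (algebraMap K F) := by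
    by_contra! h
    have := Module.card_eq_pow_finrank (K := K) (V := F)
    have h2 := Fintype.card_le_of_surjective (algebraMap K F) (fun y => h y)
    rw [this, hfin, ← hq] at h2
    nlinarith [pow_pos (by lia : 0 < q) 2, Nat.pow_lt_pow_right hq1 (by norm_num : 1 < 3)]
  have hindep : ∀ a b : K, algebraMap K F a + algebraMap K F b * θ = 0 → a = 0 ∧ b = 0 := by
    intro a b h
    by_cases hb : b = 0
    · subst hb
      simpa using h
    · exfalso
      apply hθ
      have hb' : algebraMap K F b ≠ 0 := by simpa using hb
      refine ⟨-(a / b), ?_⟩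
      rw [map_neg, map_div₀]
      field_simp
      linear_combination -h
  set W : Finset F := insert 1 (Finset.univ.image fun c : K => θ + algebraMap K F c) with hW
  have hW0 : ∀ w ∈ W, w ≠ 0 := by
    intro w hw
    simp only [hW, Finset.mem_insert, Finset.mem_image, Finset.mem_univ, true_and] at hw
    rcases hw with rfl | ⟨c, rfl⟩
    · exact one_ne_zero
    · intro h
      have := (hindep c 1 (by simpa [add_comm] using h)).2
      exact one_ne_zero this
  have hnormal : ∀ a b : K, algebraMap K F a + algebraMap K F b * θ ≠ 0 →
      ∃ k : K, k ≠ 0 ∧ ∃ w ∈ W,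
        algebraMap K F a + algebraMap K F b * θ = algebraMap K F k * w := by
    intro a b h
    by_cases hb : b = 0
    · subst hb
      refine ⟨a, ?_, 1, by simp [hW], by simp⟩
      rintro rfl
      simp at h
    · have hb' : algebraMap K F b ≠ 0 := by simpa using hb
      refine ⟨b, hb, θ + algebraMap K F (a / b),
        Finset.mem_insert_of_mem (Finset.mem_image_of_mem _ (Finset.mem_univ _)), ?_⟩
      rw [map_div₀]
      field_simp
      ring
  refine ⟨W.image fun w => ℓ w % m, ?_, ?_, ?_⟩
  · refine Finset.card_image_le.trans ((Finset.card_insert_le _ _).trans ?_)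
    exact Nat.succ_le_succ Finset.card_image_le
  · intro d hd
    obtain ⟨w, -, rfl⟩ := Finset.mem_image.mp hd
    exact ⟨Int.emod_nonneg _ hm0.ne', Int.emod_lt_of_pos _ hm0⟩
  · intro x
    let f : (Fin 4 → K) →ₗ[K] F :=
      Fintype.linearCombination K ![1, θ, -(γ : F) ^ x, -((γ : F) ^ x * θ)]
    have hf : ∀ v, f v = (algebraMap K F (v 0) + algebraMap K F (v 1) * θ)
        - (γ : F) ^ x * (algebraMap K F (v 2) + algebraMap K F (v 3) * θ) := by
      intro v
      simp only [f, Fintype.linearCombination_apply, Fin.sum_univ_four, Algebra.smul_def]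
      simp
      ring
    have hker : LinearMap.ker f ≠ ⊥ := LinearMap.ker_ne_bot_of_finrank_lt (by simp [hfin])
    obtain ⟨v, hv, hv0⟩ := Submodule.exists_mem_ne_zero_of_ne_bot hker
    rw [LinearMap.mem_ker, hf, sub_eq_zero] at hv
    have hγx : (γ : F) ^ x ≠ 0 := zpow_ne_zero _ γ.ne_zero
    have hne : ¬ ((v 0 = 0 ∧ v 1 = 0) ∧ v 2 = 0 ∧ v 3 = 0) := by
      rintro ⟨⟨h0, h1⟩, h2, h3⟩
      apply hv0
      ext i
      fin_cases i <;> simp [h0, h1, h2, h3]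
    have hnum : algebraMap K F (v 0) + algebraMap K F (v 1) * θ ≠ 0 := by
      intro h
      rw [h, eq_comm, mul_eq_zero, or_iff_right hγx] at hv
      exact hne ⟨hindep _ _ h, hindep _ _ hv⟩
    have hden : algebraMap K F (v 2) + algebraMap K F (v 3) * θ ≠ 0 := by
      intro h
      rw [h, mul_zero] at hv
      exact hnum hv
    obtain ⟨k, hk, w, hw, hkw⟩ := hnormal _ _ hnum
    obtain ⟨k', hk', w', hw', hkw'⟩ := hnormal _ _ hden
    refine ⟨_, Finset.mem_image_of_mem _ hw, _, Finset.mem_image_of_mem _ hw', ?_⟩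
    have key : m ∣ x - (ℓ w - ℓ w') := by
      apply hscalar (k / k') _ (div_ne_zero hk hk')
      have hk1 : algebraMap K F k' ≠ 0 := by simpa using hk'
      have hw1 := hW0 w hw
      have hw1' := hW0 w' hw'
      rw [hkw, hkw'] at hv
      rw [zpow_sub₀ γ.ne_zero, zpow_sub₀ γ.ne_zero, hℓ w hw1, hℓ w' hw1', map_div₀]
      field_simp
      linear_combination -hv
    have e : x - (ℓ w % m - ℓ w' % m) = x - (ℓ w - ℓ w') + m * (ℓ w / m - ℓ w' / m) := by
      have h1 := Int.emod_add_mul_ediv (ℓ w) m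
      have h2 := Int.emod_add_mul_ediv (ℓ w') m
      linear_combination -h1 + h2
    rw [e]
    exact dvd_add key (dvd_mul_right _ _)

theorem exists_cyclic_difference_cover_primePow (p k : ℕ) (hp : p.Prime) (hk : k ≠ 0) :
    ∃ D : Finset ℤ, D.card ≤ p ^ k + 1 ∧
      (∀ d ∈ D, 0 ≤ d ∧ d < ((p ^ k : ℕ) : ℤ) ^ 2 + (p ^ k : ℕ) + 1) ∧
      ∀ x : ℤ, ∃ d ∈ D, ∃ d' ∈ D,
        (((p ^ k : ℕ) : ℤ) ^ 2 + (p ^ k : ℕ) + 1) ∣ x - (d - d') := by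
  have : Fact p.Prime := ⟨hp⟩
  have := Fintype.ofFinite (GaloisField p k)
  have h := exists_cyclic_difference_cover (GaloisField p k)
    (FiniteField.Extension (GaloisField p k) p 3) (FiniteField.finrank_extension _ _ _)
  rwa [← Nat.card_eq_fintype_card, GaloisField.card p k hk] at h

theorem isGDiffBasis_Icc (g n : ℕ) : IsGDiffBasis g n (Finset.Icc 0 ((n : ℤ) + g)) := by
  intro x hx1 hxn
  have hinj : Function.Injective fun i : ℕ => ((i : ℤ) + x, (i : ℤ)) := by
    intro i j hij
    simpa using congrArg Prod.snd hij
  have hsub : (Finset.range g).image (fun i : ℕ => ((i : ℤ) + x, (i : ℤ))) ⊆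
      ((Finset.Icc 0 ((n : ℤ) + g)) ×ˢ (Finset.Icc 0 ((n : ℤ) + g))).filter
        (fun p => p.1 - p.2 = x) := by
    intro p hp
    obtain ⟨i, hi, rfl⟩ := Finset.mem_image.mp hp
    rw [Finset.mem_range] at hi
    simp only [Finset.mem_filter, Finset.mem_product, Finset.mem_Icc]
    lia
  simpa [Finset.card_image_of_injective _ hinj] using Finset.card_le_card hsub

theorem IsGDiffBasis.eta_le {g n : ℕ} {A : Finset ℤ} (hA : IsGDiffBasis g n A) :
    eta g n ≤ A.card :=
  Nat.sInf_le ⟨A, rfl, hA⟩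

theorem exists_isGDiffBasis_card_eq_eta (g n : ℕ) :
    ∃ A : Finset ℤ, A.card = eta g n ∧ IsGDiffBasis g n A :=
  Nat.sInf_mem (s := {k | ∃ A : Finset ℤ, A.card = k ∧ IsGDiffBasis g n A})
    ⟨_, _, rfl, isGDiffBasis_Icc g n⟩

theorem eta_mono (g : ℕ) : Monotone (eta g) := by
  intro n n' hn
  obtain ⟨A, hA, hbasis⟩ := exists_isGDiffBasis_card_eq_eta g n'
  rw [← hA]
  exact IsGDiffBasis.eta_le fun x hx hxn => hbasis x hx (hxn.trans (by exact_mod_cast hn))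

theorem le_eta_sq {g : ℕ} (hg : 0 < g) (n : ℕ) : n ≤ eta g n ^ 2 := by
  obtain ⟨A, hA, hbasis⟩ := exists_isGDiffBasis_card_eq_eta g n
  have hsub : Finset.Icc (1 : ℤ) n ⊆ (A ×ˢ A).image fun p => p.1 - p.2 := by
    intro x hx
    rw [Finset.mem_Icc] at hx
    obtain ⟨p, hp⟩ := Finset.card_pos.mp (hg.trans_le (hbasis x hx.1 hx.2))
    rw [Finset.mem_filter] at hp
    exact Finset.mem_image.mpr ⟨p, hp⟩
  have h := (Finset.card_le_card hsub).trans Finset.card_image_le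
  rw [Finset.card_product, hA] at h
  simpa [sq] using h

theorem IsGDiffBasis.le_card {g n : ℕ} {A : Finset ℤ} (hA : IsGDiffBasis g n A) (hn : 1 ≤ n) :
    g ≤ A.card := by
  refine (hA 1 le_rfl (by exact_mod_cast hn)).trans (Finset.card_le_card_of_injOn Prod.fst ?_ ?_)
  · intro p hp
    simp only [Finset.coe_filter, Finset.mem_product, Set.mem_ofPred_eq] at hp
    exact hp.1.1
  · intro p hp p' hp' h
    simp only [Finset.coe_filter, Finset.mem_product, Set.mem_ofPred_eq] at hp hp'
    ext
    · exact h
    · lia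

/-- A cover of the residues modulo `m` by differences, combined with a dilated difference basis. -/
theorem IsGDiffBasis.image_add_mul {g n m : ℕ} {A D : Finset ℤ} (hA : IsGDiffBasis g (n + 1) A)
    (hDm : ∀ d ∈ D, 0 ≤ d ∧ d < m) (hD : ∀ x : ℤ, ∃ d ∈ D, ∃ d' ∈ D, (m : ℤ) ∣ x - (d - d')) :
    IsGDiffBasis g (m * n) ((D ×ˢ A).image fun p => p.1 + m * p.2) := by
  intro x hx1 hxn
  obtain ⟨d, hd, d', hd', y, hy⟩ := hD x
  have hdm := hDm d hd
  have hdm' := hDm d' hd'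
  have hm : (0 : ℤ) < m := hdm.1.trans_lt hdm.2
  push_cast at hxn
  have hy0 : 0 ≤ y := by
    by_contra! h
    nlinarith
  have hyn : y ≤ n := by
    by_contra! h
    nlinarith
  have hcard : g ≤ ((A ×ˢ A).filter (fun p => p.1 - p.2 = y)).card := by
    rcases hy0.eq_or_lt with rfl | hy1
    · refine (hA.le_card (by lia)).trans
        (Finset.card_le_card_of_injOn (fun a => (a, a)) ?_ fun a _ b _ h => congrArg Prod.fst h)
      intro a ha
      simpa using ha
    · exact hA y hy1 (by push_cast; lia)
  refine hcard.trans (Finset.card_le_card_of_injOn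
    (fun p => (d + m * p.1, d' + m * p.2)) ?_ ?_)
  · intro p hp
    simp only [Finset.coe_filter, Finset.mem_product, Set.mem_ofPred_eq] at hp
    simp only [Finset.coe_filter, Finset.mem_product, Set.mem_ofPred_eq]
    refine ⟨⟨Finset.mem_image.mpr ⟨(d, p.1), by simp [hd, hp.1.1], rfl⟩,
      Finset.mem_image.mpr ⟨(d', p.2), by simp [hd', hp.1.2], rfl⟩⟩, ?_⟩
    rw [← hp.2] at hy
    linear_combination -hy
  · intro p _ p' _ h
    simp only [Prod.mk.injEq, add_right_inj, mul_eq_mul_left_iff, hm.ne', or_false] at h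
    exact Prod.ext h.1 h.2

theorem eta_primePow_sq_mul_le (g n p k : ℕ) (hp : p.Prime) (hk : k ≠ 0) :
    eta g ((p ^ k) ^ 2 * n) ≤ (p ^ k + 1) * eta g (n + 1) := by
  obtain ⟨A, hA, hbasis⟩ := exists_isGDiffBasis_card_eq_eta g (n + 1)
  obtain ⟨D, hDcard, hDm, hD⟩ := exists_cyclic_difference_cover_primePow p k hp hk
  have h := (hbasis.image_add_mul (m := (p ^ k) ^ 2 + p ^ k + 1) (D := D)
    (by exact_mod_cast hDm) (by exact_mod_cast hD)).eta_le
  calc eta g ((p ^ k) ^ 2 * n) ≤ eta g (((p ^ k) ^ 2 + p ^ k + 1) * n) :=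
        eta_mono g (Nat.mul_le_mul_right n (by lia))
    _ ≤ D.card * A.card := h.trans (Finset.card_image_le.trans (Finset.card_product _ _).le)
    _ ≤ (p ^ k + 1) * eta g (n + 1) := by rw [hA]; gcongr

theorem eta_two_three_sq_mul_le (g n a b : ℕ) (ha : a ≠ 0) (hb : b ≠ 0) :
    eta g ((2 ^ a * 3 ^ b) ^ 2 * n) ≤ (2 ^ a + 1) * (3 ^ b + 1) * eta g (n + 2) := by
  have h3 : 1 ≤ (3 ^ b) ^ 2 := Nat.one_le_pow _ _ (by positivity)
  calc eta g ((2 ^ a * 3 ^ b) ^ 2 * n) = eta g ((2 ^ a) ^ 2 * ((3 ^ b) ^ 2 * n)) := by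
        congr 1; ring
    _ ≤ (2 ^ a + 1) * eta g ((3 ^ b) ^ 2 * n + 1) :=
        eta_primePow_sq_mul_le g _ 2 a Nat.prime_two ha
    _ ≤ (2 ^ a + 1) * eta g ((3 ^ b) ^ 2 * (n + 1)) := by
        gcongr
        exact eta_mono g (by lia)
    _ ≤ (2 ^ a + 1) * ((3 ^ b + 1) * eta g (n + 2)) := by
        gcongr
        exact eta_primePow_sq_mul_le g (n + 1) 3 b Nat.prime_three hb
    _ = _ := by ring

theorem irrational_log_two_div_log_three : Irrational (Real.log 2 / Real.log 3) := by
  have h2 : 0 < Real.log 2 := Real.log_pos (by norm_num)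
  have h3 : 0 < Real.log 3 := Real.log_pos (by norm_num)
  rintro ⟨r, hr⟩
  have hr0 : 0 < r := by
    have : (0 : ℝ) < r := hr ▸ div_pos h2 h3
    exact_mod_cast this
  have hnum : (r.num.toNat : ℤ) = r.num := Int.toNat_of_nonneg (Rat.num_pos.mpr hr0).le
  have hden : (0 : ℝ) < r.den := by exact_mod_cast r.den_pos
  have hr' : (r : ℝ) = r.num.toNat / r.den := by
    rw [Rat.cast_def]
    congr 1
    exact_mod_cast hnum.symm
  rw [hr', div_eq_div_iff hden.ne' h3.ne', mul_comm (Real.log 2), ← Real.log_pow,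
    ← Real.log_pow] at hr
  have hpow : (3 : ℝ) ^ r.num.toNat = 2 ^ r.den :=
    Real.log_injOn_pos (Set.mem_Ioi.mpr (by positivity)) (Set.mem_Ioi.mpr (by positivity)) hr
  have hpow' : 3 ^ r.num.toNat = 2 ^ r.den := by exact_mod_cast hpow
  have hodd : Odd (3 ^ r.num.toNat) := Odd.pow (by decide)
  rw [hpow'] at hodd
  exact Nat.not_even_iff_odd.mpr hodd (Nat.even_pow.mpr ⟨even_two, r.den_ne_zero⟩)

/-- The natural combinations, with large coefficients, of two incommensurable reals,
one of them positive, are eventually `δ`-dense. -/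
theorem exists_forall_ge_exists_nat_combination {α β : ℝ} (hα : 0 < α)
    (hirr : Irrational (α / β)) (K : ℕ) {δ : ℝ} (hδ : 0 < δ) :
    ∃ T : ℝ, ∀ t ≥ T, ∃ a b : ℕ, K ≤ a ∧ K ≤ b ∧ t ≤ a * α + b * β ∧ a * α + b * β ≤ t + δ := by
  obtain ⟨d, hd, hd0, hdδ⟩ := (dense_addSubgroupClosure_pair_iff.mpr hirr).exists_between hδ
  obtain ⟨u, v, rfl⟩ := AddSubgroup.mem_closure_pair.mp hd
  simp only [zsmul_eq_mul] at hd0 hdδ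
  set d : ℝ := u * α + v * β with hd_def
  set J : ℤ := ⌈α / d⌉ with hJ
  set B : ℤ := K + J * (|u| + |v|) with hB
  refine ⟨B * (α + β), fun t ht => ?_⟩
  set a₀ : ℤ := ⌊(t - B * β) / α⌋ with ha₀
  have hBa : B ≤ a₀ := by
    rw [ha₀, Int.le_floor, le_div_iff₀ hα]
    linarith
  have hle : a₀ * α + B * β ≤ t := by
    have := (le_div_iff₀ hα).mp (Int.floor_le ((t - B * β) / α))
    linarith
  have hlt : t < a₀ * α + B * β + α := by
    have := (div_lt_iff₀ hα).mp (Int.lt_floor_add_one ((t - B * β) / α))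
    linarith
  set j : ℤ := ⌈(t - (a₀ * α + B * β)) / d⌉ with hj
  have hj0 : 0 ≤ j := Int.ceil_nonneg (div_nonneg (by linarith) hd0.le)
  have hjJ : j ≤ J := Int.ceil_le_ceil (by gcongr; linarith)
  have hjt : t ≤ a₀ * α + B * β + j * d := by
    have := (div_le_iff₀ hd0).mp (Int.le_ceil ((t - (a₀ * α + B * β)) / d))
    linarith
  have hjt' : a₀ * α + B * β + j * d ≤ t + d := by
    have := Int.ceil_lt_add_one ((t - (a₀ * α + B * β)) / d)
    rw [← sub_lt_iff_lt_add, lt_div_iff₀ hd0] at this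
    linarith
  have hu : -(J * |u|) ≤ j * u := by
    have := neg_abs_le u
    nlinarith [abs_nonneg u]
  have hv : -(J * |v|) ≤ j * v := by
    have := neg_abs_le v
    nlinarith [abs_nonneg v]
  have hJu : 0 ≤ J * |u| := mul_nonneg (hj0.trans hjJ) (abs_nonneg u)
  have hJv : 0 ≤ J * |v| := mul_nonneg (hj0.trans hjJ) (abs_nonneg v)
  have hKa : (K : ℤ) ≤ a₀ + j * u := by linarith
  have hKb : (K : ℤ) ≤ B + j * v := by linarith
  obtain ⟨a, ha⟩ := Int.eq_ofNat_of_zero_le ((Int.natCast_nonneg K).trans hKa)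
  obtain ⟨b, hb⟩ := Int.eq_ofNat_of_zero_le ((Int.natCast_nonneg K).trans hKb)
  have ha' : (a : ℝ) = a₀ + j * u := by exact_mod_cast ha.symm
  have hb' : (b : ℝ) = B + j * v := by exact_mod_cast hb.symm
  have hsum : (a : ℝ) * α + b * β = a₀ * α + B * β + j * d := by
    rw [ha', hb', hd_def]
    ring
  refine ⟨a, b, by lia, by lia, ?_, ?_⟩
  · rwa [hsum]
  · rw [hsum]
    linarith

theorem exists_two_three_mul_near (K : ℕ) {ε : ℝ} (hε : 0 < ε) :
    ∀ᶠ y : ℝ in Filter.atTop, ∃ a b : ℕ, K ≤ a ∧ K ≤ b ∧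
      y ≤ 2 ^ a * 3 ^ b ∧ (2 : ℝ) ^ a * 3 ^ b ≤ (1 + ε) * y := by
  obtain ⟨T, hT⟩ := exists_forall_ge_exists_nat_combination
    (Real.log_pos (by norm_num : (1 : ℝ) < 2)) irrational_log_two_div_log_three K
    (Real.log_pos (by linarith : 1 < 1 + ε))
  filter_upwards [Real.tendsto_log_atTop.eventually_ge_atTop T, Filter.eventually_gt_atTop 0]
    with y hy hy0
  obtain ⟨a, b, ha, hb, h1, h2⟩ := hT _ hy
  have hlog : (a : ℝ) * Real.log 2 + b * Real.log 3 = Real.log (2 ^ a * 3 ^ b) := by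
    rw [Real.log_mul (by positivity) (by positivity), Real.log_pow, Real.log_pow]
  rw [hlog] at h1 h2
  refine ⟨a, b, ha, hb, (Real.log_le_log_iff hy0 (by positivity)).mp h1, ?_⟩
  rw [← Real.log_mul hy0.ne' (by positivity), mul_comm y] at h2
  exact (Real.log_le_log_iff (by positivity) (by positivity)).mp h2

theorem eventually_eta_le_mul_sqrt {g n : ℕ} (hn : 0 < n) {c : ℝ}
    (hc : (eta g (n + 2) : ℝ) / Real.sqrt n < c) :
    ∀ᶠ N : ℕ in Filter.atTop, (eta g N : ℝ) ≤ c * Real.sqrt N := by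
  have hn' : (0 : ℝ) < n := by exact_mod_cast hn
  have hlim : Filter.Tendsto
      (fun ε : ℝ => (1 + ε) ^ 3 * ((eta g (n + 2) : ℝ) / Real.sqrt n))
      (nhdsWithin 0 (Set.Ioi 0)) (nhds ((eta g (n + 2) : ℝ) / Real.sqrt n)) := by
    have : Continuous fun ε : ℝ => (1 + ε) ^ 3 * ((eta g (n + 2) : ℝ) / Real.sqrt n) := by
      fun_prop
    simpa using (this.tendsto 0).mono_left nhdsWithin_le_nhds
  obtain ⟨ε, hεc, hε⟩ := ((hlim.eventually_lt_const hc).and self_mem_nhdsWithin).exists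
  obtain ⟨K, hK⟩ := pow_unbounded_of_one_lt (1 / ε) (by norm_num : (1 : ℝ) < 2)
  have hlarge : Filter.Tendsto (fun N : ℕ => Real.sqrt ((N : ℝ) / n)) Filter.atTop Filter.atTop :=
    Real.tendsto_sqrt_atTop.comp (tendsto_natCast_atTop_atTop.atTop_div_const hn')
  filter_upwards [hlarge.eventually (exists_two_three_mul_near (K + 1) hε)] with N hN
  obtain ⟨a, b, ha, hb, h1, h2⟩ := hN
  have hNs : N ≤ (2 ^ a * 3 ^ b) ^ 2 * n := by
    have := (Real.sqrt_le_left (by positivity)).mp h1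
    rw [div_le_iff₀ hn'] at this
    exact_mod_cast this
  have hadd : ∀ x : ℝ, 2 ^ K ≤ x → x + 1 ≤ (1 + ε) * x := by
    intro x hx
    have := (div_lt_iff₀ hε).mp (hK.trans_le hx)
    linarith
  have ha2 : (2 : ℝ) ^ a + 1 ≤ (1 + ε) * 2 ^ a :=
    hadd _ (pow_le_pow_right₀ (by norm_num) (by lia))
  have hb3 : (3 : ℝ) ^ b + 1 ≤ (1 + ε) * 3 ^ b :=
    hadd _ ((pow_le_pow_right₀ (by norm_num) (by lia : K ≤ b)).trans
      (pow_le_pow_left₀ (by norm_num) (by norm_num) b))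
  calc (eta g N : ℝ) ≤ (2 ^ a + 1) * (3 ^ b + 1) * eta g (n + 2) := by
        exact_mod_cast (eta_mono g hNs).trans
          (eta_two_three_sq_mul_le g n a b (by lia) (by lia))
    _ ≤ ((1 + ε) * 2 ^ a) * ((1 + ε) * 3 ^ b) * eta g (n + 2) := by gcongr
    _ = (1 + ε) ^ 2 * eta g (n + 2) * (2 ^ a * 3 ^ b) := by ring
    _ ≤ (1 + ε) ^ 2 * eta g (n + 2) * ((1 + ε) * Real.sqrt ((N : ℝ) / n)) := by gcongr
    _ = (1 + ε) ^ 3 * ((eta g (n + 2) : ℝ) / Real.sqrt n) * Real.sqrt N := by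
        rw [Real.sqrt_div (Nat.cast_nonneg N)]
        ring
    _ ≤ c * Real.sqrt N := by gcongr

theorem stmt0 (g : ℕ) (hg : 0 < g) :
    ∃ L : ℝ, 0 < L ∧
      Filter.Tendsto (fun n : ℕ => (eta g n : ℝ) / Real.sqrt n)
        Filter.atTop (nhds L) := by
  set S : Set ℝ := (fun n : ℕ => (eta g (n + 2) : ℝ) / Real.sqrt n) '' Set.Ioi 0 with hS
  have hSne : S.Nonempty := (Set.nonempty_Ioi (a := 0)).image _
  have hS1 : ∀ s ∈ S, 1 ≤ s := by
    rintro _ ⟨n, hn, rfl⟩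
    have hn' : (0 : ℝ) < n := by exact_mod_cast hn
    rw [one_le_div (Real.sqrt_pos.mpr hn')]
    refine Real.sqrt_le_iff.mpr ⟨by positivity, ?_⟩
    exact_mod_cast (Nat.le_add_right n 2).trans (le_eta_sq hg (n + 2))
  have hSbdd : BddBelow S := ⟨1, hS1⟩
  refine ⟨sInf S, zero_lt_one.trans_le (le_csInf hSne hS1), ?_⟩
  refine tendsto_order.mpr ⟨fun l hl => ?_, fun u hu => ?_⟩
  · have hratio : Filter.Tendsto (fun n : ℕ => sInf S * Real.sqrt ((n : ℝ) / (n + 2)))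
        Filter.atTop (nhds (sInf S)) := by
      have h := (Real.continuous_sqrt.tendsto 1).comp (tendsto_natCast_div_add_atTop (2 : ℝ))
      simpa using h.const_mul (sInf S)
    have hshift : ∀ᶠ n : ℕ in Filter.atTop,
        l < (eta g (n + 2) : ℝ) / Real.sqrt ((n + 2 : ℕ) : ℝ) := by
      filter_upwards [hratio.eventually_const_lt hl, Filter.eventually_gt_atTop 0] with n hln hn
      have hn' : (0 : ℝ) < Real.sqrt n := Real.sqrt_pos.mpr (by exact_mod_cast hn)
      refine hln.trans_le ?_
      calc sInf S * Real.sqrt ((n : ℝ) / (n + 2))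
          ≤ (eta g (n + 2) : ℝ) / Real.sqrt n * Real.sqrt ((n : ℝ) / (n + 2)) := by
            gcongr
            exact csInf_le hSbdd ⟨n, hn, rfl⟩
        _ = _ := by
            rw [Real.sqrt_div (Nat.cast_nonneg n)]
            push_cast
            field_simp
    obtain ⟨M, hM⟩ := Filter.eventually_atTop.mp hshift
    filter_upwards [Filter.eventually_ge_atTop (M + 2)] with n hn
    obtain ⟨k, rfl⟩ := Nat.exists_eq_add_of_le' (show 2 ≤ n by lia)
    exact hM k (by lia)
  · obtain ⟨_, ⟨n, hn, rfl⟩, hlt⟩ := exists_lt_of_csInf_lt hSne hu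
    obtain ⟨c, hc, hcu⟩ := exists_between hlt
    filter_upwards [eventually_eta_le_mul_sqrt hn hc, Filter.eventually_gt_atTop 0]
      with N hN hN0
    have hN' : (0 : ℝ) < Real.sqrt N := Real.sqrt_pos.mpr (by exact_mod_cast hN0)
    exact ((div_le_iff₀ hN').mpr hN).trans_lt hcu
end

section
/- Let q, v, g be positive integers and set m = q² + q + 1. Suppose a₀, a₁, …, a_q are integers in {1, …, m} such that the q² + q differences a_i − a_j (over ordered pairs of distinct indices i ≠ j) are congruent modulo m to the numbers 1, 2, …, q² + q in some order (i.e., the map (i,j) ↦ (a_i − a_j mod m) is a bijection from ordered pairs of distinct indices onto the nonzero residues mod m). If B is a g-difference basis for [v], then the set F = {a_i + m·b : 0 ≤ i ≤ q, b ∈ B} is a g-difference basis for [mv]. -/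
theorem IsGDiffBasis.le_card_of_nonneg {g n : ℕ} {A : Finset ℤ} (hA : IsGDiffBasis g n A)
    (hn : 0 < n) {y : ℤ} (hy : 0 ≤ y) (hyn : y ≤ n) :
    g ≤ ((A ×ˢ A).filter (fun p => p.1 - p.2 = y)).card := by
  rcases hy.eq_or_lt with rfl | hpos
  · refine (hA 1 le_rfl (by exact_mod_cast hn)).trans ?_
    refine Finset.card_le_card_of_injOn (fun p => (p.1, p.1)) ?_ ?_
    · intro p hp
      simp only [Finset.coe_filter, Finset.mem_product, Set.mem_ofPred_eq] at hp ⊢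
      exact ⟨⟨hp.1.1, hp.1.1⟩, sub_self _⟩
    · intro p hp r hr h
      simp only [Finset.coe_filter, Finset.mem_product, Set.mem_ofPred_eq, Prod.mk.injEq] at hp hr h
      ext
      · exact h.1
      · linarith [hp.2, hr.2, h.1]
  · exact hA y hpos hyn

theorem stmt6 (q v g : ℕ) (hq : 0 < q) (hv : 0 < v) (hg : 0 < g)
    (m : ℕ) (hm : m = q ^ 2 + q + 1)
    (a : Fin (q + 1) → ℤ)
    (ha : ∀ i, a i ∈ Finset.Icc (1 : ℤ) (m : ℤ))
    (hbij : ∀ x : ZMod m, x ≠ 0 →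
      ∃! p : Fin (q + 1) × Fin (q + 1),
        p.1 ≠ p.2 ∧ ((a p.1 - a p.2 : ℤ) : ZMod m) = x)
    (B : Finset ℤ) (hB : IsGDiffBasis g v B)
    (F : Finset ℤ)
    (hF : F = (Finset.univ ×ˢ B).image
      (fun p : Fin (q + 1) × ℤ => a p.1 + (m : ℤ) * p.2)) :
    IsGDiffBasis g (m * v) F := by
  intro x hx hxv
  have hm0 : (0 : ℤ) < m := by rw [hm]; positivity
  obtain ⟨i, j, hij⟩ : ∃ i j, ((a i - a j : ℤ) : ZMod m) = (x : ZMod m) := by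
    by_cases h : (x : ZMod m) = 0
    · exact ⟨0, 0, by simp [h]⟩
    · obtain ⟨p, hp, -⟩ := hbij x h
      exact ⟨p.1, p.2, hp.2⟩
  obtain ⟨y, hy⟩ := (ZMod.intCast_eq_intCast_iff_dvd_sub _ _ _).1 hij
  have hi := Finset.mem_Icc.1 (ha i)
  have hj := Finset.mem_Icc.1 (ha j)
  push_cast at hxv
  have hy0 : 0 ≤ y := by
    have : (m : ℤ) * (-1) < m * y := by linarith
    linarith [Int.add_one_le_iff.2 (lt_of_mul_lt_mul_left this hm0.le)]
  have hyv : y ≤ v := by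
    have : (m : ℤ) * y < m * (v + 1) := by linarith
    exact Int.lt_add_one_iff.1 (lt_of_mul_lt_mul_left this hm0.le)
  refine (hB.le_card_of_nonneg hv hy0 hyv).trans ?_
  refine Finset.card_le_card_of_injOn (fun p => (a i + m * p.1, a j + m * p.2)) ?_ ?_
  · intro p hp
    simp only [Finset.coe_filter, Finset.mem_product, Set.mem_ofPred_eq] at hp ⊢
    rw [hF]
    refine ⟨⟨Finset.mem_image.2 ⟨(i, p.1), by simp [hp.1.1], rfl⟩,
      Finset.mem_image.2 ⟨(j, p.2), by simp [hp.1.2], rfl⟩⟩, ?_⟩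
    rw [← hp.2] at hy
    linarith
  · intro p _ r _ h
    simp only [Prod.mk.injEq, add_right_inj] at h
    ext
    · exact mul_left_cancel₀ hm0.ne' h.1
    · exact mul_left_cancel₀ hm0.ne' h.2
end

section
/- Let q be an odd prime power and let F_q denote the finite field with q elements. Then η_1(F_q × F_q) ≤ q + η_1(F_q), where the groups are the additive groups of F_q × F_q and F_q respectively. (Explicitly: if B ⊆ F_q is a difference basis of minimum size, then {(x, x²) : x ∈ F_q} ∪ {(0, b) : b ∈ B} is a difference basis of F_q × F_q.) -/
/-- `etaOne G` is the smallest cardinality of a difference basis of the abelian group `G`,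
i.e. of a finite set `A ⊆ G` such that every `x ∈ G` is a difference of two elements of `A`. -/
noncomputable def etaOne (G : Type*) [AddCommGroup G] : ℕ :=
  sInf {k | ∃ A : Finset G, A.card = k ∧ ∀ x : G, ∃ a ∈ A, ∃ b ∈ A, a - b = x}

/-- A finite difference basis bounds `etaOne` from above. -/
theorem etaOne_le_card {G : Type*} [AddCommGroup G] (A : Finset G)
    (hA : ∀ x : G, ∃ a ∈ A, ∃ b ∈ A, a - b = x) : etaOne G ≤ A.card :=
  Nat.sInf_le ⟨A, rfl, hA⟩

/-- In a finite group, `etaOne` is attained by some difference basis. -/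
theorem exists_card_eq_etaOne (G : Type*) [AddCommGroup G] [Finite G] :
    ∃ A : Finset G, A.card = etaOne G ∧ ∀ x : G, ∃ a ∈ A, ∃ b ∈ A, a - b = x := by
  have := Fintype.ofFinite G
  exact Nat.sInf_mem
    (s := {k | ∃ A : Finset G, A.card = k ∧ ∀ x : G, ∃ a ∈ A, ∃ b ∈ A, a - b = x})
    ⟨_, Finset.univ, rfl, fun x => ⟨x, Finset.mem_univ _, 0, Finset.mem_univ _, sub_zero x⟩⟩

/-- Away from characteristic two, every vector with nonzero first coordinate is a difference of
two points of the parabola. -/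
theorem exists_parabola_sub_eq {F : Type*} [Field F] (h2 : (2 : F) ≠ 0) {u : F} (hu : u ≠ 0)
    (v : F) : ∃ x y : F, (x, x ^ 2) - (y, y ^ 2) = (u, v) := by
  refine ⟨(v / u + u) / 2, (v / u - u) / 2, Prod.ext ?_ ?_⟩
  · simp only [Prod.fst_sub]
    field_simp
    ring
  · simp only [Prod.snd_sub]
    field_simp
    ring

theorem stmt10 (q : ℕ) (hodd : Odd q)
    (hq : ∃ p k : ℕ, p.Prime ∧ 0 < k ∧ q = p ^ k)
    (F : Type*) [Field F] [Fintype F] (hcard : Fintype.card F = q) :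
    etaOne (F × F) ≤ q + etaOne F := by
  classical
  have h2 : (2 : F) ≠ 0 := Ring.two_ne_zero fun h => by
    have := FiniteField.even_card_of_char_two h
    rw [hcard, Nat.odd_iff.mp hodd] at this
    exact one_ne_zero this
  obtain ⟨B, hBcard, hB⟩ := exists_card_eq_etaOne F
  let P : Finset (F × F) := Finset.univ.image fun x : F => (x, x ^ 2)
  let V : Finset (F × F) := B.image fun b => (0, b)
  have hP (x : F) : (x, x ^ 2) ∈ P ∪ V :=
    Finset.mem_union_left _ (Finset.mem_image_of_mem _ (Finset.mem_univ x))
  have hV {b : F} (hb : b ∈ B) : (0, b) ∈ P ∪ V :=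
    Finset.mem_union_right _ (Finset.mem_image_of_mem _ hb)
  calc etaOne (F × F) ≤ (P ∪ V).card := etaOne_le_card _ ?_
    _ ≤ P.card + V.card := Finset.card_union_le _ _
    _ ≤ q + etaOne F :=
      add_le_add (Finset.card_image_le.trans_eq hcard) (Finset.card_image_le.trans_eq hBcard)
  rintro ⟨u, v⟩
  by_cases hu : u = 0
  · obtain ⟨a, ha, b, hb, rfl⟩ := hB v
    exact ⟨_, hV ha, _, hV hb, by simp [hu]⟩
  · obtain ⟨x, y, hxy⟩ := exists_parabola_sub_eq h2 hu v
    exact ⟨_, hP x, _, hP y, hxy⟩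
end

section
/- Let p be an odd prime and let q = pⁿ be a power of p. Then η_1(F_q) ≤ 100√q, where F_q is the additive group of the finite field with q elements. -/
theorem etaOne_le_of_surjective {G H : Type*} [AddCommGroup G] [Finite G] [AddCommGroup H]
    (f : G →+ H) (hf : Function.Surjective f) : etaOne H ≤ etaOne G := by
  classical
  obtain ⟨A, hcard, hA⟩ := exists_card_eq_etaOne G
  rw [← hcard]
  refine (etaOne_le_card (A.image f) fun y => ?_).trans Finset.card_image_le
  obtain ⟨x, rfl⟩ := hf y
  obtain ⟨a, ha, b, hb, rfl⟩ := hA x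
  exact ⟨f a, Finset.mem_image_of_mem f ha, f b, Finset.mem_image_of_mem f hb, (map_sub f a b).symm⟩

theorem etaOne_prod_le (G H : Type*) [AddCommGroup G] [Finite G] [AddCommGroup H] [Finite H] :
    etaOne (G × H) ≤ etaOne G * etaOne H := by
  obtain ⟨A, hcardA, hA⟩ := exists_card_eq_etaOne G
  obtain ⟨B, hcardB, hB⟩ := exists_card_eq_etaOne H
  rw [← hcardA, ← hcardB, ← Finset.card_product]
  refine etaOne_le_card _ fun ⟨x, y⟩ => ?_
  obtain ⟨a, ha, a', ha', rfl⟩ := hA x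
  obtain ⟨b, hb, b', hb', rfl⟩ := hB y
  exact ⟨(a, b), Finset.mk_mem_product ha hb, (a', b'), Finset.mk_mem_product ha' hb', rfl⟩

theorem etaOne_prod_self_le (G : Type*) [AddCommGroup G] [Fintype G] :
    etaOne (G × G) ≤ 2 * Fintype.card G := by
  classical
  refine (etaOne_le_card (Finset.univ.image (fun g : G => (g, (0 : G))) ∪
    Finset.univ.image (fun g : G => ((0 : G), g))) fun ⟨x, y⟩ => ?_).trans ?_
  · exact ⟨(x, 0), by simp, (0, -y), by simp, by simp⟩
  · refine (Finset.card_union_le _ _).trans ?_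
    rw [two_mul]
    exact add_le_add Finset.card_image_le Finset.card_image_le

theorem etaOne_zmod_le (p : ℕ) [NeZero p] : etaOne (ZMod p) ≤ 2 * (p.sqrt + 1) := by
  set k := p.sqrt + 1 with hk
  refine (etaOne_le_card ((Finset.range k).image (fun i => ((k * i : ℕ) : ZMod p)) ∪
    (Finset.range k).image (fun i => -((i : ℕ) : ZMod p))) fun x => ?_).trans ?_
  · refine ⟨((k * (x.val / k) : ℕ) : ZMod p),
      Finset.mem_union_left _ (Finset.mem_image.2 ⟨_, Finset.mem_range.2 ?_, rfl⟩),
      -((x.val % k : ℕ) : ZMod p),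
      Finset.mem_union_right _ (Finset.mem_image.2 ⟨_, Finset.mem_range.2 ?_, rfl⟩), ?_⟩
    · exact Nat.div_lt_of_lt_mul (x.val_lt.trans (Nat.lt_succ_sqrt p))
    · exact Nat.mod_lt _ (Nat.succ_pos _)
    · rw [sub_neg_eq_add, ← Nat.cast_add, Nat.div_add_mod, ZMod.natCast_zmod_val]
  · refine (Finset.card_union_le _ _).trans ?_
    rw [two_mul]
    exact add_le_add (Finset.card_image_le.trans_eq (Finset.card_range k))
      (Finset.card_image_le.trans_eq (Finset.card_range k))

theorem etaOne_zmod_le_four_mul_sqrt (p : ℕ) [NeZero p] :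
    (etaOne (ZMod p) : ℝ) ≤ 4 * Real.sqrt p := by
  have h : (etaOne (ZMod p) : ℝ) ≤ 2 * ((p.sqrt : ℝ) + 1) := by exact_mod_cast etaOne_zmod_le p
  have h₁ : (p.sqrt : ℝ) ≤ Real.sqrt p := Real.nat_sqrt_le_real_sqrt
  have h₂ : 1 ≤ Real.sqrt p :=
    Real.one_le_sqrt.2 (by exact_mod_cast Nat.one_le_iff_ne_zero.2 (NeZero.ne p))
  linarith

theorem stmt11 (p n : ℕ) (hp : p.Prime) (hodd : Odd p) (hn : 0 < n)
    (F : Type*) [Field F] [Fintype F] (hcard : Fintype.card F = p ^ n) :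
    (etaOne F : ℝ) ≤ 100 * Real.sqrt ((p : ℝ) ^ n) := by
  have : Fact p.Prime := ⟨hp⟩
  have : CharP F p := charP_of_card_eq_prime_pow hcard
  let : Algebra (ZMod p) F := ZMod.algebra F p
  have hrank : Module.finrank (ZMod p) F = n := by
    have h := Module.card_eq_pow_finrank (K := ZMod p) (V := F)
    rw [hcard, ZMod.card] at h
    exact (Nat.pow_right_injective hp.two_le h).symm
  have hplane (m : ℕ) : (etaOne ((Fin m → ZMod p) × (Fin m → ZMod p)) : ℝ) ≤ 2 * (p : ℝ) ^ m := by
    have h := etaOne_prod_self_le (Fin m → ZMod p)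
    rw [Fintype.card_fun, ZMod.card, Fintype.card_fin] at h
    exact_mod_cast h
  have hpos (m : ℕ) : (0 : ℝ) ≤ (p : ℝ) ^ m := by positivity
  obtain ⟨m, rfl | rfl⟩ := Nat.even_or_odd' n
  · let e : ((Fin m → ZMod p) × (Fin m → ZMod p)) ≃ₗ[ZMod p] F :=
      LinearEquiv.ofFinrankEq _ _ (by simp [hrank, two_mul])
    have h : (etaOne F : ℝ) ≤ etaOne ((Fin m → ZMod p) × (Fin m → ZMod p)) := by
      exact_mod_cast etaOne_le_of_surjective e.toAddEquiv.toAddMonoidHom e.surjective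
    rw [mul_comm 2 m, pow_mul, Real.sqrt_sq (hpos m)]
    linarith [hplane m, hpos m]
  · let e : (ZMod p × ((Fin m → ZMod p) × (Fin m → ZMod p))) ≃ₗ[ZMod p] F :=
      LinearEquiv.ofFinrankEq _ _ (by simp [hrank]; ring)
    have h : (etaOne F : ℝ) ≤
        etaOne (ZMod p) * etaOne ((Fin m → ZMod p) × (Fin m → ZMod p)) := by
      exact_mod_cast (etaOne_le_of_surjective e.toAddEquiv.toAddMonoidHom e.surjective).trans
        (etaOne_prod_le _ _)
    rw [pow_succ, mul_comm 2 m, pow_mul, Real.sqrt_mul (sq_nonneg _), Real.sqrt_sq (hpos m)]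
    calc (etaOne F : ℝ) ≤ _ := h
      _ ≤ 4 * Real.sqrt p * (2 * (p : ℝ) ^ m) := by
        gcongr
        · exact etaOne_zmod_le_four_mul_sqrt p
        · exact hplane m
      _ ≤ 100 * ((p : ℝ) ^ m * Real.sqrt p) := by
        linarith [mul_nonneg (hpos m) (Real.sqrt_nonneg p)]
end

section
/- Let p be a fixed odd prime. Then η_1(F_{p^t} × F_{p^t}) = (1 + o(1))·p^t as t → ∞; that is, lim_{t→∞} η_1(F_{p^t} × F_{p^t}) / p^t = 1, where F_{p^t} denotes the additive group of the finite field with p^t elements. -/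
theorem card_le_etaOne_sq (G : Type*) [AddCommGroup G] [Finite G] :
    Nat.card G ≤ etaOne G ^ 2 := by
  have := Fintype.ofFinite G
  have hne : {k | ∃ A : Finset G, A.card = k ∧ ∀ x : G, ∃ a ∈ A, ∃ b ∈ A, a - b = x}.Nonempty :=
    ⟨_, Finset.univ, rfl, fun x => ⟨x, Finset.mem_univ _, 0, Finset.mem_univ _, sub_zero x⟩⟩
  obtain ⟨A, hcard, hA⟩ := Nat.sInf_mem hne
  change A.card = etaOne G at hcard
  classical
  have hsurj : (A ×ˢ A).image (fun z => z.1 - z.2) = Finset.univ := by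
    ext x
    obtain ⟨a, ha, b, hb, h⟩ := hA x
    simp only [Finset.mem_image, Finset.mem_univ, iff_true]
    exact ⟨(a, b), Finset.mk_mem_product ha hb, h⟩
  have h := Finset.card_image_le (s := A ×ˢ A) (f := fun z => z.1 - z.2)
  rwa [hsurj, Finset.card_univ, Finset.card_product, hcard, ← sq, ← Nat.card_eq_fintype_card] at h

/-- The parabola `{(x, x ^ 2)}` realises every difference outside the vertical axis, so it
suffices to add a difference basis of the vertical axis. -/
theorem etaOne_prod_self_le_s12 (F : Type*) [Field F] [Finite F] (h2 : (2 : F) ≠ 0) (B : Finset F)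
    (hB : ∀ x : F, ∃ a ∈ B, ∃ b ∈ B, a - b = x) :
    etaOne (F × F) ≤ Nat.card F + B.card := by
  classical
  have := Fintype.ofFinite F
  let P : Finset (F × F) := Finset.univ.image fun x : F => (x, x ^ 2)
  let V : Finset (F × F) := B.image fun y => ((0 : F), y)
  have hcard : (P ∪ V).card ≤ Nat.card F + B.card := by
    rw [Nat.card_eq_fintype_card]
    exact (Finset.card_union_le _ _).trans
      (Nat.add_le_add Finset.card_image_le Finset.card_image_le)
  refine (etaOne_le_card (P ∪ V) ?_).trans hcard
  rintro ⟨d, e⟩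
  by_cases hd : d = 0
  · obtain ⟨a, ha, b, hb, h⟩ := hB e
    refine ⟨(0, a), Finset.mem_union_right _ (Finset.mem_image_of_mem _ ha), (0, b),
      Finset.mem_union_right _ (Finset.mem_image_of_mem _ hb), ?_⟩
    simp [h, hd]
  · have hmem (x : F) : (x, x ^ 2) ∈ P ∪ V :=
      Finset.mem_union_left _ (Finset.mem_image_of_mem _ (Finset.mem_univ x))
    refine ⟨_, hmem ((e / d + d) / 2), _, hmem ((e / d - d) / 2), ?_⟩
    ext
    · simp only [Prod.fst_sub]
      field_simp
      ring
    · simp only [Prod.snd_sub]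
      field_simp
      ring

/-- A vector space of dimension `a + b` over `ZMod p` is the sum of subspaces of dimensions
`a` and `b`, whose union is a difference basis. -/
theorem exists_differenceBasis_card_le (p : ℕ) [Fact p.Prime] (V : Type*) [AddCommGroup V]
    [Module (ZMod p) V] [Module.Finite (ZMod p) V] {a b : ℕ}
    (hab : Module.finrank (ZMod p) V = a + b) :
    ∃ B : Finset V, B.card ≤ p ^ a + p ^ b ∧ ∀ x : V, ∃ u ∈ B, ∃ v ∈ B, u - v = x := by
  classical
  let e : ((Fin a → ZMod p) × (Fin b → ZMod p)) ≃ₗ[ZMod p] V :=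
    LinearEquiv.ofFinrankEq _ _ (by simp [hab])
  refine ⟨Finset.univ.image (fun x : Fin a → ZMod p => e (x, 0)) ∪
    Finset.univ.image (fun y : Fin b → ZMod p => e (0, y)), ?_, fun x => ?_⟩
  · refine (Finset.card_union_le _ _).trans (Nat.add_le_add ?_ ?_) <;>
    · refine Finset.card_image_le.trans ?_
      simp [ZMod.card]
  · refine ⟨e ((e.symm x).1, 0),
      Finset.mem_union_left _ (Finset.mem_image_of_mem _ (Finset.mem_univ _)),
      e (0, -(e.symm x).2),
      Finset.mem_union_right _ (Finset.mem_image.2 ⟨_, Finset.mem_univ _, rfl⟩), ?_⟩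
    rw [← map_sub]
    simp

theorem stmt12 (p : ℕ) [Fact p.Prime] (hodd : Odd p) :
    Filter.Tendsto
      (fun t : ℕ => (etaOne (GaloisField p t × GaloisField p t) : ℝ) / (p : ℝ) ^ t)
      Filter.atTop (nhds 1) := by
  have hp : 1 < p := (Fact.out : p.Prime).one_lt
  have hp0 : (0 : ℝ) < p := by exact_mod_cast hp.pos
  have hhalf : Filter.Tendsto (fun t : ℕ => t / 2) Filter.atTop Filter.atTop :=
    Nat.tendsto_div_const_atTop two_ne_zero
  have hhalf' : Filter.Tendsto (fun t : ℕ => t - t / 2) Filter.atTop Filter.atTop :=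
    Filter.tendsto_atTop_mono (fun t => by omega) hhalf
  have hpow : Filter.Tendsto (fun n : ℕ => ((p : ℝ)⁻¹) ^ n) Filter.atTop (nhds 0) :=
    tendsto_pow_atTop_nhds_zero_of_lt_one (inv_nonneg.2 hp0.le)
      (inv_lt_one_of_one_lt₀ (by exact_mod_cast hp))
  have hupper : Filter.Tendsto
      (fun t : ℕ => 1 + (((p : ℝ)⁻¹) ^ (t - t / 2) + ((p : ℝ)⁻¹) ^ (t / 2)))
      Filter.atTop (nhds 1) := by
    simpa using ((hpow.comp hhalf').add (hpow.comp hhalf)).const_add (1 : ℝ)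
  refine tendsto_of_tendsto_of_tendsto_of_le_of_le' tendsto_const_nhds hupper ?_ ?_
  · filter_upwards [Filter.eventually_ne_atTop 0] with t ht
    have h := card_le_etaOne_sq (GaloisField p t × GaloisField p t)
    rw [Nat.card_prod, GaloisField.card p t ht, ← sq, Nat.pow_le_pow_iff_left two_ne_zero] at h
    rw [one_le_div (by positivity)]
    exact_mod_cast h
  · filter_upwards [Filter.eventually_ne_atTop 0] with t ht
    have h2 : (2 : GaloisField p t) ≠ 0 :=
      Ring.two_ne_zero (by
        rw [ringChar.eq (GaloisField p t) p]
        rintro rfl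
        exact absurd hodd (by decide))
    obtain ⟨B, hBcard, hB⟩ := exists_differenceBasis_card_le p (GaloisField p t)
      (a := t / 2) (b := t - t / 2) (by rw [GaloisField.finrank p ht]; omega)
    have h := (etaOne_prod_self_le_s12 _ h2 B hB).trans (Nat.add_le_add_left hBcard _)
    rw [GaloisField.card p t ht] at h
    have hsplit : (p : ℝ) ^ t = (p : ℝ) ^ (t / 2) * (p : ℝ) ^ (t - t / 2) := by
      rw [← pow_add]
      congr 1
      omega
    rw [div_le_iff₀ (by positivity)]
    calc (etaOne (GaloisField p t × GaloisField p t) : ℝ)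
        ≤ (p : ℝ) ^ t + ((p : ℝ) ^ (t / 2) + (p : ℝ) ^ (t - t / 2)) := by exact_mod_cast h
      _ = _ := by
        rw [hsplit, inv_pow, inv_pow]
        field_simp
end

section
/- Let p be a fixed odd prime and g a fixed positive integer. Then the limit L_e = lim_{k→∞} η_g(F_p^{2k}) / √(p^{2k}) exists and is a positive real number, where F_p^{2k} denotes the additive group of the 2k-dimensional vector space over the field with p elements. -/
/-- `etaG g G` is the smallest cardinality of a `g`-difference basis of the abelian
group `G`: a finite set `A ⊆ G` such that for every `x ∈ G` there are at least `g`
ordered pairs `(a, a') ∈ A × A` with `a - a' = x`. -/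
noncomputable def etaG (g : ℕ) (G : Type*) [AddCommGroup G] [DecidableEq G] : ℕ :=
  sInf {k | ∃ A : Finset G, A.card = k ∧
    ∀ x : G, g ≤ ((A ×ˢ A).filter (fun p => p.1 - p.2 = x)).card}

open Filter Topology

/-- A finite set `A` is a `g`-difference basis if every element of the group is a difference of
at least `g` ordered pairs of elements of `A`. -/
def IsDiffBasis (g : ℕ) {G : Type*} [AddCommGroup G] [DecidableEq G] (A : Finset G) : Prop :=
  ∀ x : G, g ≤ ((A ×ˢ A).filter (fun p => p.1 - p.2 = x)).card

section
variable {g : ℕ} {G H : Type*} [AddCommGroup G] [DecidableEq G] [AddCommGroup H] [DecidableEq H]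

/-- A difference basis can be recognised by the minuends of the representations alone. -/
lemma isDiffBasis_iff {A : Finset G} :
    IsDiffBasis g A ↔
      ∀ x : G, ∃ f : Fin g → G, Function.Injective f ∧ ∀ i, f i ∈ A ∧ f i - x ∈ A := by
  refine forall_congr' fun x => ?_
  have hcard : ((A ×ˢ A).filter (fun p => p.1 - p.2 = x)).card
      = (A.filter (fun a => a - x ∈ A)).card := by
    refine Finset.card_nbij' (fun p => p.1) (fun a => (a, a - x)) ?_ ?_ ?_ ?_
    · rintro ⟨a, b⟩ h
      simp only [Finset.coe_filter, Finset.mem_product, Set.mem_ofPred_eq] at h ⊢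
      obtain ⟨⟨ha, hb⟩, rfl⟩ := h
      simpa using ⟨ha, hb⟩
    · intro a h
      simp only [Finset.coe_filter, Finset.mem_product, Set.mem_ofPred_eq] at h ⊢
      simpa using h
    · rintro ⟨a, b⟩ h
      simp only [Finset.coe_filter, Finset.mem_product, Set.mem_ofPred_eq] at h
      obtain ⟨-, rfl⟩ := h
      simp
    · intro a _
      rfl
  rw [hcard]
  constructor
  · intro h
    obtain ⟨e⟩ : Nonempty (Fin g ↪ (A.filter (fun a => a - x ∈ A))) :=
      Function.Embedding.nonempty_of_card_le (by simpa using h)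
    exact ⟨fun i => e i, Subtype.val_injective.comp e.injective,
      fun i => Finset.mem_filter.1 (e i).2⟩
  · rintro ⟨f, hf, hA⟩
    simpa using Finset.card_le_card_of_injOn (s := (Finset.univ : Finset (Fin g))) f
      (fun i _ => by simpa using hA i) hf.injOn

lemma IsDiffBasis.etaG_le {A : Finset G} (hA : IsDiffBasis g A) : etaG g G ≤ A.card :=
  Nat.sInf_le ⟨A, rfl, hA⟩

lemma exists_isDiffBasis_card_eq_etaG [Fintype G] (h : g ≤ Fintype.card G) :
    ∃ A : Finset G, A.card = etaG g G ∧ IsDiffBasis g A := by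
  refine Nat.sInf_mem (s := {k | ∃ A : Finset G, A.card = k ∧ IsDiffBasis g A})
    ⟨_, Finset.univ, rfl, isDiffBasis_iff.2 fun x => ?_⟩
  obtain ⟨e⟩ : Nonempty (Fin g ↪ G) :=
    Function.Embedding.nonempty_of_card_le (by simpa using h)
  exact ⟨e, e.injective, by simp⟩

lemma card_le_etaG_sq [Fintype G] (hg : 0 < g) (h : g ≤ Fintype.card G) :
    Fintype.card G ≤ etaG g G ^ 2 := by
  obtain ⟨A, hA, hb⟩ := exists_isDiffBasis_card_eq_etaG h
  rw [← hA, sq, ← Finset.card_product, ← Finset.card_univ]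
  refine Finset.card_le_card_of_surjOn (fun p : G × G => p.1 - p.2) fun x _ => ?_
  obtain ⟨q, hq⟩ := Finset.card_pos.1 (hg.trans_le (hb x))
  rw [Finset.mem_filter] at hq
  exact ⟨q, hq.1, hq.2⟩

lemma etaG_le_of_addEquiv [Fintype G] (h : g ≤ Fintype.card G) (e : G ≃+ H) :
    etaG g H ≤ etaG g G := by
  obtain ⟨A, hA, hb⟩ := exists_isDiffBasis_card_eq_etaG h
  have hb' : IsDiffBasis g (A.map e.toEquiv.toEmbedding) := by
    refine isDiffBasis_iff.2 fun x => ?_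
    obtain ⟨f, hf, hfA⟩ := isDiffBasis_iff.1 hb (e.symm x)
    refine ⟨fun i => e (f i), e.injective.comp hf, fun i => ⟨?_, ?_⟩⟩
    · simpa using (hfA i).1
    · simpa [Finset.mem_map_equiv] using (hfA i).2
  simpa [hA] using hb'.etaG_le

/-- Placing pairwise transversal lines of the plane `F × F` over the points of a difference basis
of `G`, together with a small difference basis of the plane over `0`, gives a difference basis of
`G × (F × F)`. -/
lemma etaG_prod_plane_le [Fintype G] (F : Type*) [Field F] [Fintype F] [DecidableEq F]
    (h : g ≤ Fintype.card G) (hF : Fintype.card G ≤ Fintype.card F) :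
    etaG g (G × (F × F)) ≤ (etaG g G + (g + 1)) * Fintype.card F := by
  obtain ⟨A, hA, hb⟩ := exists_isDiffBasis_card_eq_etaG h
  obtain ⟨φ⟩ : Nonempty (G ↪ F) := Function.Embedding.nonempty_of_card_le hF
  obtain ⟨ψ⟩ : Nonempty (Fin g ↪ F) :=
    Function.Embedding.nonempty_of_card_le (by simpa using h.trans hF)
  let B₁ : Finset (G × (F × F)) :=
    (A ×ˢ Finset.univ).image fun q : G × F => (q.1, (q.2, φ q.1 * q.2))
  let B₂ : Finset (G × (F × F)) := Finset.univ.image fun t : F => (0, (t, 0))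
  let B₃ : Finset (G × (F × F)) := Finset.univ.image fun q : Fin g × F => (0, (ψ q.1, q.2))
  have h₁ (a : G) (ha : a ∈ A) (s t : F) (hst : t = φ a * s) : (a, (s, t)) ∈ B₁ :=
    Finset.mem_image.2 ⟨(a, s), by simpa using ha, by simp [hst]⟩
  have h₂ (s : F) : (0, (s, 0)) ∈ B₂ := Finset.mem_image.2 ⟨s, by simp, rfl⟩
  have h₃ (i : Fin g) (t : F) : (0, (ψ i, t)) ∈ B₃ := Finset.mem_image.2 ⟨(i, t), by simp, rfl⟩
  have hB : IsDiffBasis g (B₁ ∪ (B₂ ∪ B₃)) := by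
    refine isDiffBasis_iff.2 ?_
    rintro ⟨v, s, t⟩
    by_cases hv : v = 0
    · subst hv
      refine ⟨fun i => (0, (s + ψ i, 0)), fun i j hij => ?_, fun i => ⟨?_, ?_⟩⟩
      · simpa using hij
      · exact Finset.mem_union_right _ (Finset.mem_union_left _ (h₂ _))
      · simpa using Or.inr (Or.inr (h₃ i (-t)))
    · obtain ⟨f, hf, hfA⟩ := isDiffBasis_iff.1 hb v
      refine ⟨fun i => (f i, ((t - φ (f i - v) * s) / (φ (f i) - φ (f i - v)),
        φ (f i) * ((t - φ (f i - v) * s) / (φ (f i) - φ (f i - v))))), fun i j hij => ?_,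
        fun i => ⟨Finset.mem_union_left _ (h₁ _ (hfA i).1 _ _ rfl),
          Finset.mem_union_left _ (h₁ _ (hfA i).2 _ _ ?_)⟩⟩
      · exact hf (Prod.ext_iff.1 hij).1
      · have hne : φ (f i) - φ (f i - v) ≠ 0 := by
          rw [sub_ne_zero]
          intro heq
          exact hv (sub_eq_self.1 (φ.injective heq).symm)
        field_simp
        ring
  have c₁ : B₁.card ≤ A.card * Fintype.card F :=
    Finset.card_image_le.trans (by simp)
  have c₂ : B₂.card ≤ Fintype.card F := Finset.card_image_le.trans (by simp)
  have c₃ : B₃.card ≤ g * Fintype.card F := Finset.card_image_le.trans (by simp)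
  calc etaG g (G × (F × F)) ≤ (B₁ ∪ (B₂ ∪ B₃)).card := hB.etaG_le
    _ ≤ B₁.card + (B₂.card + B₃.card) :=
      (Finset.card_union_le _ _).trans (by gcongr; exact Finset.card_union_le _ _)
    _ ≤ A.card * Fintype.card F + (Fintype.card F + g * Fintype.card F) := by gcongr
    _ = (etaG g G + (g + 1)) * Fintype.card F := by rw [hA]; ring

end

lemma etaG_zmod_add_le {p g k n : ℕ} [Fact p.Prime] (h : g ≤ p ^ (2 * k)) (hn : 2 * k ≤ n) :
    etaG g (Fin (2 * (k + n)) → ZMod p) ≤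
      (etaG g (Fin (2 * k) → ZMod p) + (g + 1)) * p ^ n := by
  classical
  have hp1 : 1 < p := (Fact.out : p.Prime).one_lt
  rcases Nat.eq_zero_or_pos n with rfl | hnpos
  · have : k = 0 := by omega
    subst this
    simp
  have hn0 : n ≠ 0 := hnpos.ne'
  have hcardF : Nat.card (GaloisField p n) = p ^ n := GaloisField.card p n hn0
  let : Fintype (GaloisField p n) := Fintype.ofFinite _
  rw [Nat.card_eq_fintype_card] at hcardF
  have hcardV : Fintype.card (Fin (2 * k) → ZMod p) = p ^ (2 * k) := by simp [ZMod.card]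
  have hVF : p ^ (2 * k) ≤ p ^ n := Nat.pow_le_pow_right hp1.le hn
  have e : ((Fin (2 * k) → ZMod p) × (GaloisField p n × GaloisField p n)) ≃ₗ[ZMod p]
      (Fin (2 * (k + n)) → ZMod p) := by
    refine LinearEquiv.ofFinrankEq _ _ ?_
    simp [GaloisField.finrank p hn0]
    ring
  refine (etaG_le_of_addEquiv ?_ e.toAddEquiv).trans ?_
  · rw [Fintype.card_prod, hcardV]
    exact h.trans (Nat.le_mul_of_pos_right _ Fintype.card_pos)
  · rw [← hcardF]
    exact etaG_prod_plane_le _ (hcardV ▸ h) (by rw [hcardV, hcardF]; exact hVF)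

/-- A form of Fekete's lemma with a vanishing error term. -/
lemma exists_tendsto_of_eventually_le_add {u ε : ℕ → ℝ} {c : ℝ} {K : ℕ}
    (hε : Tendsto ε atTop (𝓝 0)) (hε0 : ∀ k, 0 ≤ ε k) (hc : ∀ k, K ≤ k → c ≤ u k)
    (hu : ∀ k, K ≤ k → ∀ᶠ m in atTop, u m ≤ u k + ε k) :
    ∃ L, c ≤ L ∧ Tendsto u atTop (𝓝 L) := by
  set S : Set ℝ := (fun k => u k + ε k) '' Set.Ici K
  have hS : S.Nonempty := Set.nonempty_Ici.image _
  have hlow : c ∈ lowerBounds S := by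
    rintro _ ⟨k, hk, rfl⟩
    exact (hc k hk).trans (le_add_of_nonneg_right (hε0 k))
  refine ⟨sInf S, le_csInf hS hlow, tendsto_order.2 ⟨fun a ha => ?_, fun a ha => ?_⟩⟩
  · filter_upwards [hε.eventually_lt_const (sub_pos.2 ha), eventually_ge_atTop K] with k h1 h2
    have : sInf S ≤ u k + ε k := csInf_le ⟨c, hlow⟩ ⟨k, h2, rfl⟩
    linarith
  · obtain ⟨_, ⟨k, hk, rfl⟩, hlt⟩ := exists_lt_of_csInf_lt hS ha
    filter_upwards [hu k hk] with m hm
    exact hm.trans_lt hlt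

theorem stmt13 (p : ℕ) (hp : p.Prime) (hodd : Odd p) (g : ℕ) (hg : 0 < g) :
    ∃ L : ℝ, 0 < L ∧
      Filter.Tendsto
        (fun k : ℕ =>
          (etaG g (Fin (2 * k) → ZMod p) : ℝ) / Real.sqrt ((p : ℝ) ^ (2 * k)))
        Filter.atTop (nhds L) := by
  have : Fact p.Prime := ⟨hp⟩
  have hp1 : (1 : ℝ) < p := by exact_mod_cast hp.one_lt
  have hp0 : (0 : ℝ) < p := by linarith
  have hsqrt (k : ℕ) : Real.sqrt ((p : ℝ) ^ (2 * k)) = (p : ℝ) ^ k := by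
    rw [mul_comm, pow_mul, Real.sqrt_sq (by positivity)]
  simp only [hsqrt]
  have hgk (k : ℕ) (hk : g ≤ k) : g ≤ p ^ (2 * k) :=
    (Nat.lt_pow_self hp.one_lt).le.trans (Nat.pow_le_pow_right hp.pos (by omega))
  obtain ⟨L, hL, hlim⟩ := exists_tendsto_of_eventually_le_add
    (u := fun k => (etaG g (Fin (2 * k) → ZMod p) : ℝ) / (p : ℝ) ^ k)
    (ε := fun k => ((g : ℝ) + 1) / (p : ℝ) ^ k) (c := 1) (K := g)
    (tendsto_const_nhds.div_atTop (tendsto_pow_atTop_atTop_of_one_lt hp1))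
    (fun k => by positivity)
    (fun k hk => by
      have hcard : Fintype.card (Fin (2 * k) → ZMod p) = p ^ (2 * k) := by simp [ZMod.card]
      have h := card_le_etaG_sq (G := Fin (2 * k) → ZMod p) hg (hcard ▸ hgk k hk)
      rw [hcard, mul_comm 2 k, pow_mul, mul_comm k 2] at h
      rw [one_le_div (by positivity)]
      exact_mod_cast (Nat.pow_le_pow_iff_left two_ne_zero).1 h)
    (fun k hk => by
      filter_upwards [eventually_ge_atTop (3 * k)] with m hm
      obtain ⟨n, rfl⟩ : ∃ n, m = k + n := ⟨m - k, by omega⟩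
      have h := etaG_zmod_add_le (n := n) (hgk k hk) (by omega)
      rw [← add_div, div_le_div_iff₀ (by positivity) (by positivity), pow_add]
      have h' : (etaG g (Fin (2 * (k + n)) → ZMod p) : ℝ) ≤
          (etaG g (Fin (2 * k) → ZMod p) + (g + 1)) * (p : ℝ) ^ n := by exact_mod_cast h
      calc _ ≤ ((etaG g (Fin (2 * k) → ZMod p) + (g + 1)) * (p : ℝ) ^ n) * (p : ℝ) ^ k := by
            gcongr
        _ = _ := by ring)
  exact ⟨L, by linarith, hlim⟩
end

section
/- Let g be a fixed positive integer. Then α_g(n) = (1 + o_g(1))·√(gn) as n → ∞; that is, lim_{n→∞} α_g(n)/√(gn) = 1. -/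
/-- `alpha g n` is the largest cardinality of a subset `A ⊆ {1, …, n}` such that for
every nonzero integer `x` there are at most `g` ordered pairs `(a₁, a₂) ∈ A × A`
with `a₁ - a₂ = x`. -/
noncomputable def alpha (g n : ℕ) : ℕ :=
  sSup {k | ∃ A : Finset ℤ, A ⊆ Finset.Icc (1 : ℤ) (n : ℤ) ∧ A.card = k ∧
    ∀ x : ℤ, x ≠ 0 → ((A ×ˢ A).filter (fun p => p.1 - p.2 = x)).card ≤ g}

open MeasureTheory FourierTransform Filter Topology
open scoped Convolution ContDiff ComplexConjugate

lemma conj_fourier_ofReal (f : ℝ → ℝ) (u : ℝ) :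
    𝓕 (fun t : ℝ => (f (-t) : ℂ)) u = conj (𝓕 (fun t : ℝ => (f t : ℂ)) u) := by
  rw [Real.fourier_real_eq_integral_exp_smul, Real.fourier_real_eq_integral_exp_smul,
    ← integral_conj, ← integral_neg_eq_self]
  refine integral_congr_ae (Eventually.of_forall fun t => ?_)
  simp [← Complex.exp_conj, Complex.conj_ofNat]

lemma exists_autocorrelation (f : ℝ → ℝ) (hf : ContDiff ℝ ∞ f) (hc : HasCompactSupport f) :
    ∃ φ : ℝ → ℂ, Continuous φ ∧ HasCompactSupport φ ∧
      (∀ u, 𝓕 φ u = ((‖𝓕 (fun t : ℝ => (f t : ℂ)) u‖ ^ 2 : ℝ) : ℂ)) ∧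
      Integrable (fun u => ‖𝓕 (fun t : ℝ => (f t : ℂ)) u‖ ^ 2) ∧
      ∫ u, ‖𝓕 (fun t : ℝ => (f t : ℂ)) u‖ ^ 2 = ∫ t, f t ^ 2 := by
  have hF : ContDiff ℝ ∞ (fun t : ℝ => (f t : ℂ)) := Complex.ofRealCLM.contDiff.comp hf
  have hFc : HasCompactSupport (fun t : ℝ => (f t : ℂ)) :=
    hc.comp_left (g := fun x : ℝ => (x : ℂ)) Complex.ofReal_zero
  have hFn : HasCompactSupport (fun t : ℝ => (f (-t) : ℂ)) :=
    hFc.comp_homeomorph (Homeomorph.neg ℝ)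
  have hFnc : Continuous (fun t : ℝ => (f (-t) : ℂ)) := hF.continuous.comp continuous_neg
  have hi := hF.continuous.integrable_of_hasCompactSupport hFc (μ := volume)
  have hin := hFnc.integrable_of_hasCompactSupport hFn (μ := volume)
  let S := hFc.toSchwartzMap hF
  have hS : (S : ℝ → ℂ) = fun t : ℝ => (f t : ℂ) := by
    ext t; simp [S]
  refine ⟨(fun t : ℝ => (f t : ℂ)) ⋆[ContinuousLinearMap.mul ℂ ℂ] (fun t : ℝ => (f (-t) : ℂ)),
    ?_, ?_, ?_, ?_, ?_⟩
  · exact hFn.continuous_convolution_right _ hi.locallyIntegrable hFnc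
  · exact HasCompactSupport.convolution _ hFc hFn
  · intro u
    rw [Real.fourier_mul_convolution_eq hi hin, conj_fourier_ofReal, Complex.mul_conj,
      Complex.normSq_eq_norm_sq]
  · have := ((𝓕 S).memLp 2 volume).integrable_norm_pow (by norm_num)
    rw [SchwartzMap.fourier_coe, hS] at this
    simpa using this
  · have := S.integral_norm_sq_fourier
    rw [SchwartzMap.fourier_coe, hS] at this
    rw [this]
    simp

lemma exists_bandlimited_minorant : ∃ (φ : ℝ → ℂ) (H : ℝ → ℝ) (D : ℝ), Continuous φ ∧
    HasCompactSupport φ ∧ (∀ u, 𝓕 φ u = (H u : ℂ)) ∧ Integrable H ∧ 0 < ∫ u, H u ∧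
    0 < D ∧ ∀ u, D ≤ |u| → H u ≤ 0 := by
  let b : ContDiffBump (0 : ℝ) := ⟨1, 2, one_pos, one_lt_two⟩
  have hb : ContDiff ℝ ∞ (b : ℝ → ℝ) := b.contDiff
  have hbd : ContDiff ℝ ∞ (deriv (b : ℝ → ℝ)) := hb.deriv'
  have hbc : HasCompactSupport (b : ℝ → ℝ) := b.hasCompactSupport
  obtain ⟨φ₀, h₀c, h₀s, h₀F, h₀i, h₀I⟩ := exists_autocorrelation b hb hbc
  obtain ⟨φ₁, h₁c, h₁s, h₁F, h₁i, h₁I⟩ := exists_autocorrelation _ hbd hbc.deriv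
  have hpos : 0 < ∫ t, b t ^ 2 := by
    refine Continuous.integral_pos_of_hasCompactSupport_nonneg_nonzero (x := 0)
      (b.continuous.pow 2) ?_ (fun t => sq_nonneg _) ?_
    · exact hbc.comp_left (g := fun x : ℝ => x ^ 2) (by simp)
    · have : b 0 = 1 := b.one_of_mem_closedBall (by simp [b])
      simp [this]
  have hnn : 0 ≤ ∫ t, deriv (b : ℝ → ℝ) t ^ 2 := integral_nonneg fun t => sq_nonneg _
  set I₀ := ∫ t, b t ^ 2
  set I₁ := ∫ t, deriv (b : ℝ → ℝ) t ^ 2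
  set c : ℝ := I₀ / (I₁ + 1)
  have hc : 0 < c := by positivity
  have hd : ∀ u, ‖𝓕 (fun t : ℝ => ((deriv (b : ℝ → ℝ) t : ℝ) : ℂ)) u‖ ^ 2 =
      4 * Real.pi ^ 2 * u ^ 2 * ‖𝓕 (fun t : ℝ => (b t : ℂ)) u‖ ^ 2 := by
    intro u
    have hB : ContDiff ℝ ∞ (fun t : ℝ => (b t : ℂ)) := Complex.ofRealCLM.contDiff.comp hb
    have hBc : HasCompactSupport (fun t : ℝ => (b t : ℂ)) :=
      hbc.comp_left (g := fun x : ℝ => (x : ℂ)) Complex.ofReal_zero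
    have hder : deriv (fun t : ℝ => (b t : ℂ)) = fun t : ℝ => ((deriv (b : ℝ → ℝ) t : ℝ) : ℂ) := by
      ext t
      exact ((hb.differentiable (by simp)) t).hasDerivAt.ofReal_comp.deriv
    have := Real.fourier_deriv (hB.continuous.integrable_of_hasCompactSupport hBc)
      (hB.differentiable (by simp))
      ((hB.continuous_deriv (by simp)).integrable_of_hasCompactSupport hBc.deriv)
    rw [← hder, this]
    simp only [smul_eq_mul, norm_mul, Complex.norm_real, Complex.norm_I, Complex.norm_ofNat, Real.norm_eq_abs,
      mul_pow, sq_abs, abs_of_pos Real.pi_pos]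
    ring
  refine ⟨φ₀ - (c : ℂ) • φ₁, fun u => ‖𝓕 (fun t : ℝ => (b t : ℂ)) u‖ ^ 2 -
    c * ‖𝓕 (fun t : ℝ => ((deriv (b : ℝ → ℝ) t : ℝ) : ℂ)) u‖ ^ 2, 1 / (2 * Real.pi * √c), ?_, ?_, ?_, ?_, ?_, ?_, ?_⟩
  · exact h₀c.sub (h₁c.const_smul _)
  · exact h₀s.sub (h₁s.comp_left (g := fun x : ℂ => (c : ℂ) • x) (smul_zero _))
  · intro u
    have hi₀ := h₀c.integrable_of_hasCompactSupport h₀s (μ := volume)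
    have hi₁ := h₁c.integrable_of_hasCompactSupport h₁s (μ := volume)
    have e : 𝓕 (φ₀ - (c : ℂ) • φ₁) u = 𝓕 φ₀ u - (c : ℂ) * 𝓕 φ₁ u := by
      simp only [Real.fourier_eq, Pi.sub_apply, Pi.smul_apply, smul_sub]
      have := integral_sub ((Real.fourierIntegral_convergent_iff u).2 hi₀)
        ((Real.fourierIntegral_convergent_iff u).2 (hi₁.smul (c : ℂ)))
      simp only [Pi.smul_apply] at this
      rw [this, ← smul_eq_mul, ← integral_smul]
      simp only [smul_comm (c : ℂ)]
    rw [e, h₀F, h₁F]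
    push_cast
    ring
  · exact h₀i.sub (h₁i.const_mul c)
  · rw [integral_sub h₀i (h₁i.const_mul c), integral_const_mul, h₀I, h₁I]
    change 0 < I₀ - c * I₁
    have : c * I₁ = I₀ * (I₁ / (I₁ + 1)) := by simp only [c]; ring
    have h2 : I₁ / (I₁ + 1) < 1 := by rw [div_lt_one (by positivity)]; linarith
    nlinarith
  · positivity
  · intro u hu
    simp only [hd, ← mul_assoc c]
    have : 1 ≤ c * (4 * Real.pi ^ 2 * u ^ 2) := by
      rw [div_le_iff₀ (by positivity)] at hu
      have h1 : 1 ≤ (|u| * (2 * Real.pi * √c)) ^ 2 := one_le_pow₀ hu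
      rw [mul_pow, mul_pow, mul_pow, sq_abs, Real.sq_sqrt hc.le] at h1
      linarith
    nlinarith [sq_nonneg ‖𝓕 (fun t : ℝ => (b t : ℂ)) u‖]


lemma integral_fourier_kernel_div {φ : ℝ → ℂ} {H : ℝ → ℝ} (hφ : Integrable φ)
    (hφH : ∀ u, 𝓕 φ u = (H u : ℂ)) {κ : ℝ} (hκ : 0 < κ) (l y : ℝ) :
    ∫ t : ℝ, φ t * Complex.exp (2 * Real.pi * l * t * y * Complex.I) *
        (1 / (κ + 2 * Real.pi * l * t * Complex.I)) =
      ((∫ v in Set.Ioi (0 : ℝ), Real.exp (-κ * v) * H (l * (v - y)) : ℝ) : ℂ) := by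
  have h1 : ∀ t : ℝ, 1 / (κ + 2 * Real.pi * l * t * Complex.I) =
      ∫ v in Set.Ioi (0 : ℝ), Complex.exp (-(κ + 2 * Real.pi * l * t * Complex.I) * v) := by
    intro t
    rw [integral_exp_mul_complex_Ioi (by simpa using hκ)]
    rw [Complex.ofReal_zero, mul_zero, Complex.exp_zero, neg_div_neg_eq]
  simp_rw [h1, ← integral_const_mul]
  rw [integral_integral_swap]
  · rw [← integral_complex_ofReal]
    refine integral_congr_ae (Eventually.of_forall fun v => ?_)
    simp only [Complex.ofReal_mul, ← hφH, Real.fourier_real_eq_integral_exp_smul]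
    rw [← integral_const_mul]
    refine integral_congr_ae (Eventually.of_forall fun t => ?_)
    simp only [smul_eq_mul, Complex.ofReal_exp]
    rw [mul_assoc, ← Complex.exp_add, mul_comm, mul_left_comm, ← mul_assoc, ← Complex.exp_add]
    congr 2
    push_cast
    ring
  · have hp : Integrable (fun p : ℝ × ℝ => φ p.1 * ((Real.exp (-κ * p.2) : ℝ) : ℂ))
        (volume.prod (volume.restrict (Set.Ioi 0))) :=
      hφ.mul_prod (integrableOn_exp_mul_Ioi (by linarith) 0).ofReal
    refine hp.mono ?_ (Eventually.of_forall fun p => ?_)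
    · refine AEStronglyMeasurable.mul (AEStronglyMeasurable.mul ?_ ?_) ?_
      · exact hφ.aestronglyMeasurable.comp_fst
      · exact Continuous.aestronglyMeasurable (by fun_prop)
      · exact Continuous.aestronglyMeasurable (by fun_prop)
    · simp [Function.uncurry, Complex.norm_exp]

lemma hasSum_fourier_kernel {φ : ℝ → ℂ} {H : ℝ → ℝ} (hφ : Integrable φ)
    (hφH : ∀ u, 𝓕 φ u = (H u : ℂ)) {f : ℕ → ℝ} {σ : ℝ}
    (hs : LSeriesSummable (fun n => (f n : ℂ)) σ) (l y : ℝ) :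
    HasSum (fun n : ℕ => if n = 0 then 0 else f n / n ^ σ * H (l * (Real.log n - y)))
      (∫ t : ℝ, φ t * Complex.exp (2 * Real.pi * l * t * y * Complex.I) *
        LSeries (fun n => (f n : ℂ)) (σ + 2 * Real.pi * l * t * Complex.I)).re := by
  have hn : ∀ (n : ℕ) (t : ℝ),
     ‖LSeries.term (fun n => (f n : ℂ)) (σ + 2 * Real.pi * l * t * Complex.I) n‖ =
     ‖LSeries.term (fun n => (f n : ℂ)) σ n‖ := by
    intro n t
    rw [LSeries.norm_term_eq, LSeries.norm_term_eq]
    simp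
  have key : ∀ (n : ℕ), ∫ t : ℝ, φ t * Complex.exp (2 * Real.pi * l * t * y * Complex.I) *
      LSeries.term (fun n => (f n : ℂ)) (σ + 2 * Real.pi * l * t * Complex.I) n =
      ((if n = 0 then 0 else f n / n ^ σ * H (l * (Real.log n - y)) : ℝ) : ℂ) := by
    intro n
    rcases eq_or_ne n 0 with rfl | hn0
    · simp
    simp only [hn0, LSeries.term_def, if_false]
    have hn' : (n : ℂ) ≠ 0 := by exact_mod_cast hn0
    push_cast
    rw [← hφH, Real.fourier_real_eq_integral_exp_smul, ← integral_const_mul]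
    refine integral_congr_ae (Eventually.of_forall fun t => ?_)
    simp only [smul_eq_mul]
    rw [Complex.cpow_add _ _ hn', Complex.ofReal_cpow (Nat.cast_nonneg n), Complex.ofReal_natCast,
      Complex.cpow_def_of_ne_zero hn' (2 * _ * _ * _ * _), ← Complex.natCast_log]
    have : Complex.exp (↑(-2 * Real.pi * t * (l * (Real.log n - y))) * Complex.I) =
        Complex.exp (2 * Real.pi * l * t * y * Complex.I) /
        Complex.exp (Real.log n * (2 * Real.pi * l * t * Complex.I)) := by
      rw [← Complex.exp_sub]
      congr 1
      push_cast
      ring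
    rw [this]
    have h3 : (n : ℂ) ^ (σ : ℂ) ≠ 0 := by simp [Complex.cpow_eq_zero_iff, hn']
    field_simp
  have h_integrable : ∀ n : ℕ, Integrable (fun t : ℝ =>
      φ t * Complex.exp (2 * Real.pi * l * t * y * Complex.I) *
      LSeries.term (fun n => (f n : ℂ)) (σ + 2 * Real.pi * l * t * Complex.I) n) := by
    intro n
    rcases eq_or_ne n 0 with rfl | hn0
    · simp
    have hn' : (n : ℂ) ≠ 0 := by exact_mod_cast hn0
    refine (hφ.mul_const (LSeries.term (fun n => (f n : ℂ)) σ n)).mono ?_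
      (Eventually.of_forall fun t => ?_)
    · refine (hφ.aestronglyMeasurable.mul ?_).mul ?_
      · exact Continuous.aestronglyMeasurable (by fun_prop)
      · simp only [LSeries.term_def, hn0, if_false]
        refine Continuous.aestronglyMeasurable ?_
        refine continuous_const.div ?_ fun t => by simp [Complex.cpow_eq_zero_iff, hn']
        exact Continuous.const_cpow (by fun_prop) (Or.inl hn')
    · simp [Complex.norm_exp, hn]
  have := hasSum_integral_of_summable_integral_norm h_integrable ?_
  · simp only [key] at this
    have h2 := Complex.hasSum_re this
    simp only [Complex.ofReal_re] at h2
    convert h2 using 2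
    refine integral_congr_ae (Eventually.of_forall fun t => ?_)
    simp only [LSeries, tsum_mul_left]
  · simp only [norm_mul, hn]
    simp only [integral_mul_const]
    exact hs.norm.mul_left _

lemma eventually_exists_mem_of_LSeries {f : ℕ → ℝ} (hf : ∀ n, 0 ≤ f n)
    (hs : ∀ s : ℂ, 1 < s.re → LSeriesSummable (fun n => (f n : ℂ)) s) {G : ℂ → ℂ}
    (hG : ContinuousOn G {s | 1 ≤ s.re}) {c : ℝ} (hc : 0 < c)
    (hFG : ∀ s : ℂ, 1 < s.re → LSeries (fun n => (f n : ℂ)) s = G s + c * (1 / (s - 1)))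
    {P : Set ℕ} (hP : Summable fun n : ℕ => Pᶜ.indicator f n / n) {δ : ℝ} (hδ : 0 < δ) :
    ∀ᶠ y : ℝ in atTop, ∃ n ∈ P, |Real.log n - y| < δ := by
  obtain ⟨φ, H, D, hφc, hφs, hφH, hHi, hHI, hD, hHD⟩ := exists_bandlimited_minorant
  have hφ : Integrable φ := hφc.integrable_of_hasCompactSupport hφs
  set l := D / δ with hl
  have hl0 : 0 < l := by positivity
  have hHlim : Tendsto H (cocompact ℝ) (𝓝 0) := by
    have := Real.zero_at_infty_fourier φ
    rw [show 𝓕 φ = fun u => (H u : ℂ) from funext hφH] at this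
    exact_mod_cast (Complex.continuous_re.tendsto _).comp this
  obtain ⟨C, hC⟩ : ∃ C, ∀ u, |H u| ≤ C := by
    refine ⟨∫ t, ‖φ t‖, fun u => ?_⟩
    rw [← Real.norm_eq_abs, ← Complex.norm_real, ← hφH]
    exact VectorFourier.norm_fourierIntegral_le_integral_norm Real.fourierChar volume (innerₗ ℝ) φ u
  set R : ℝ → ℝ → ℂ := fun σ y => ∫ t : ℝ, φ t *
    Complex.exp (2 * Real.pi * l * t * y * Complex.I) * G (σ + 2 * Real.pi * l * t * Complex.I)
    with hR
  set J : ℝ → ℝ → ℝ := fun κ y => ∫ v in Set.Ioi (0 : ℝ), Real.exp (-κ * v) * H (l * (v - y))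
    with hJ
  set E : ℝ → ℝ := fun y => ∑' n : ℕ, Pᶜ.indicator f n / n * |H (l * (Real.log n - y))| with hE
  have hGc : ∀ σ : ℝ, 1 ≤ σ → Continuous fun t : ℝ => G (σ + 2 * Real.pi * l * t * Complex.I) := by
    intro σ hσ
    refine hG.comp_continuous (by fun_prop) fun t => ?_
    simpa using hσ
  have hRint : ∀ σ : ℝ, 1 ≤ σ → ∀ y : ℝ, Integrable fun t : ℝ => φ t *
      Complex.exp (2 * Real.pi * l * t * y * Complex.I) *
      G (σ + 2 * Real.pi * l * t * Complex.I) := by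
    intro σ hσ y
    refine Continuous.integrable_of_hasCompactSupport ?_ ?_
    · exact (hφc.mul (by fun_prop)).mul (hGc σ hσ)
    · exact (hφs.mul_right).mul_right
  have hsum : ∀ σ : ℝ, 1 < σ → ∀ y : ℝ,
      HasSum (fun n : ℕ => if n = 0 then 0 else f n / n ^ σ * H (l * (Real.log n - y)))
        ((R σ y).re + c * J (σ - 1) y) := by
    intro σ hσ y
    have hκ : 0 < σ - 1 := by linarith
    have h1 := hasSum_fourier_kernel hφ hφH (hs σ (by simpa using hσ)) l y
    have h2 := integral_fourier_kernel_div hφ hφH hκ l y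
    have hi2 : Integrable fun t : ℝ => φ t * Complex.exp (2 * Real.pi * l * t * y * Complex.I) *
        (1 / (((σ - 1 : ℝ) : ℂ) + 2 * Real.pi * l * t * Complex.I)) := by
      refine Continuous.integrable_of_hasCompactSupport ?_ ?_
      · refine (hφc.mul (by fun_prop)).mul (continuous_const.div (by fun_prop) fun t h => ?_)
        have := congrArg Complex.re h
        simp at this
        linarith
      · exact (hφs.mul_right).mul_right
    convert h1 using 1
    have h3 : ∀ t : ℝ, φ t * Complex.exp (2 * Real.pi * l * t * y * Complex.I) *
        LSeries (fun n => (f n : ℂ)) (σ + 2 * Real.pi * l * t * Complex.I) =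
        φ t * Complex.exp (2 * Real.pi * l * t * y * Complex.I) *
        G (σ + 2 * Real.pi * l * t * Complex.I) +
        c * (φ t * Complex.exp (2 * Real.pi * l * t * y * Complex.I) *
        (1 / (((σ - 1 : ℝ) : ℂ) + 2 * Real.pi * l * t * Complex.I))) := by
      intro t
      rw [hFG _ (by simpa using hσ)]
      push_cast
      rw [show (σ : ℂ) + 2 * Real.pi * l * t * Complex.I - 1 =
        σ - 1 + 2 * Real.pi * l * t * Complex.I by ring]
      ring
    simp_rw [h3]
    rw [integral_add (hRint σ hσ.le y) (hi2.const_mul _), integral_const_mul, h2, Complex.add_re,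
      Complex.re_ofReal_mul, Complex.ofReal_re]
  have hEsum : ∀ y, Summable fun n : ℕ => Pᶜ.indicator f n / n * |H (l * (Real.log n - y))| := by
    intro y
    refine (hP.mul_right C).of_nonneg_of_le (fun n => ?_) (fun n => ?_)
    · have := Set.indicator_nonneg (s := Pᶜ) (fun n _ => hf n) n
      positivity
    · have := Set.indicator_nonneg (s := Pᶜ) (fun n _ => hf n) n
      gcongr
      exact hC _
  have hRlim : ∀ y, Tendsto (fun σ => R σ y) (𝓝[>] 1) (𝓝 (R 1 y)) := by
    intro y
    obtain ⟨M, hM⟩ : ∃ M, ∀ σ ∈ Set.Icc (1 : ℝ) 2, ∀ t ∈ tsupport φ,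
        ‖G (σ + 2 * Real.pi * l * t * Complex.I)‖ ≤ M := by
      have hK : IsCompact (Set.Icc (1 : ℝ) 2 ×ˢ tsupport φ) := isCompact_Icc.prod hφs
      have hcont : ContinuousOn (fun p : ℝ × ℝ => G (p.1 + 2 * Real.pi * l * p.2 * Complex.I))
          (Set.Icc (1 : ℝ) 2 ×ˢ tsupport φ) := by
        refine hG.comp (Continuous.continuousOn (by fun_prop)) fun p hp => ?_
        simpa using hp.1.1
      obtain ⟨M, hM⟩ := hK.exists_bound_of_continuousOn hcont
      exact ⟨M, fun σ hσ t ht => hM (σ, t) ⟨hσ, ht⟩⟩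
    refine tendsto_integral_filter_of_dominated_convergence (fun t => ‖φ t‖ * M) ?_ ?_ ?_ ?_
    · filter_upwards [self_mem_nhdsWithin] with σ hσ
      exact (hRint σ (le_of_lt hσ) y).aestronglyMeasurable
    · filter_upwards [Ioo_mem_nhdsGT (show (1 : ℝ) < 2 by norm_num)] with σ hσ
      refine Eventually.of_forall fun t => ?_
      by_cases ht : t ∈ tsupport φ
      · have := hM σ ⟨hσ.1.le, hσ.2.le⟩ t ht
        rw [norm_mul, norm_mul, Complex.norm_exp]
        simp only [Complex.mul_re, Complex.mul_im, Complex.ofReal_re, Complex.ofReal_im,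
          Complex.I_re, Complex.I_im, Complex.re_ofNat, Complex.im_ofNat]
        simp
        gcongr
      · simp [image_eq_zero_of_notMem_tsupport ht]
    · exact hφ.norm.mul_const _
    · refine Eventually.of_forall fun t => Tendsto.const_mul _ ?_
      have h1 : ContinuousWithinAt (fun σ : ℝ => G (σ + 2 * Real.pi * l * t * Complex.I))
          (Set.Ici 1) 1 := by
        refine (hG.comp (s := Set.Ici (1 : ℝ)) (Continuous.continuousOn (by fun_prop))
          fun σ hσ => ?_) 1 Set.self_mem_Ici
        simpa using hσ
      exact h1.mono Set.Ioi_subset_Ici_self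
  have hHc : Continuous H := by
    have : Continuous (𝓕 φ) := VectorFourier.fourierIntegral_continuous Real.continuous_fourierChar
      (by exact continuous_inner) hφ
    rw [show 𝓕 φ = fun u => (H u : ℂ) from funext hφH] at this
    exact_mod_cast Complex.continuous_re.comp this
  have hHl : ∀ y, Integrable fun v => H (l * (v - y)) := fun y =>
    (hHi.comp_mul_left' hl0.ne').comp_sub_right y
  have hJlim : ∀ y, Tendsto (fun σ => J (σ - 1) y) (𝓝[>] 1) (𝓝 (J 0 y)) := by
    intro y
    refine tendsto_integral_filter_of_dominated_convergence (fun v => ‖H (l * (v - y))‖) ?_ ?_ ?_ ?_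
    · exact Eventually.of_forall fun σ => Continuous.aestronglyMeasurable (by fun_prop)
    · filter_upwards [self_mem_nhdsWithin] with σ hσ
      filter_upwards [ae_restrict_mem measurableSet_Ioi] with v hv
      rw [norm_mul]
      refine mul_le_of_le_one_left (norm_nonneg _) ?_
      rw [Real.norm_eq_abs, Real.abs_exp, Real.exp_le_one_iff]
      have h1 : (1 : ℝ) < σ := hσ
      have h2 : (0 : ℝ) < v := hv
      nlinarith
    · exact (hHl y).norm.integrableOn
    · refine Eventually.of_forall fun v => ?_
      have : Continuous fun σ : ℝ => Real.exp (-(σ - 1) * v) * H (l * (v - y)) := by fun_prop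
      have h := (this.tendsto 1).mono_left (nhdsWithin_le_nhds (s := Set.Ioi 1))
      simpa using h
  have hbound : ∀ y, (¬ ∃ n ∈ P, |Real.log n - y| < δ) → (R 1 y).re + c * J 0 y ≤ E y := by
    intro y hy
    push Not at hy
    have hlim : Tendsto (fun σ => (R σ y).re + c * J (σ - 1) y) (𝓝[>] 1)
        (𝓝 ((R 1 y).re + c * J 0 y)) :=
      ((Complex.continuous_re.tendsto _).comp (hRlim y)).add ((hJlim y).const_mul c)
    refine le_of_tendsto hlim ?_
    filter_upwards [self_mem_nhdsWithin] with σ hσ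
    have hσ : 1 < σ := hσ
    refine hasSum_le (fun n => ?_) (hsum σ hσ y) (hEsum y).hasSum
    have hind := Set.indicator_nonneg (s := Pᶜ) (fun n _ => hf n) n
    split_ifs with h0
    · positivity
    have hn : (1 : ℝ) ≤ n := by exact_mod_cast Nat.one_le_iff_ne_zero.2 h0
    by_cases hnP : n ∈ P
    · have h1 : H (l * (Real.log n - y)) ≤ 0 := by
        apply hHD
        rw [abs_mul, abs_of_pos hl0, hl, div_mul_eq_mul_div, le_div_iff₀ hδ]
        exact mul_le_mul_of_nonneg_left (hy n hnP) hD.le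
      have h2 : 0 ≤ f n / (n : ℝ) ^ σ := div_nonneg (hf n) (by positivity)
      exact (mul_nonpos_of_nonneg_of_nonpos h2 h1).trans (by positivity)
    · rw [Set.indicator_of_mem (show n ∈ Pᶜ from hnP)]
      have h1 : (n : ℝ) ≤ (n : ℝ) ^ σ := by
        simpa using Real.rpow_le_rpow_of_exponent_le hn hσ.le
      calc f n / (n : ℝ) ^ σ * H (l * (Real.log n - y))
          ≤ f n / (n : ℝ) ^ σ * |H (l * (Real.log n - y))| := by
            have := div_nonneg (hf n) (show (0 : ℝ) ≤ (n : ℝ) ^ σ by positivity)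
            gcongr
            exact le_abs_self _
        _ ≤ _ := by
            have := hf n
            gcongr
  have hR1 : Tendsto (fun y => R 1 y) atTop (𝓝 0) := by
    have h1 := Real.zero_at_infty_fourier
      (fun t : ℝ => φ t * G ((1 : ℝ) + 2 * Real.pi * l * t * Complex.I))
    have h2 : Tendsto (fun y : ℝ => -l * y) atTop (cocompact ℝ) :=
      (tendsto_id.const_mul_atTop_of_neg (by linarith)).mono_right atBot_le_cocompact
    refine (h1.comp h2).congr fun y => ?_
    simp only [Function.comp, Real.fourier_real_eq_integral_exp_smul, hR]
    refine integral_congr_ae (Eventually.of_forall fun t => ?_)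
    simp only [smul_eq_mul]
    rw [show ((-2 * Real.pi * t * (-l * y) : ℝ) : ℂ) * Complex.I =
      2 * Real.pi * l * t * y * Complex.I by push_cast; ring]
    ring
  have hJ1 : Tendsto (fun y => J 0 y) atTop (𝓝 (l⁻¹ * ∫ u, H u)) := by
    have h1 := (aecover_Ioi (μ := (volume : Measure ℝ))
      (tendsto_neg_atTop_atBot (G := ℝ))).integral_tendsto_of_countably_generated
      (hHi.comp_mul_left' hl0.ne')
    rw [Measure.integral_comp_mul_left, abs_of_pos (inv_pos.2 hl0), smul_eq_mul] at h1
    refine h1.congr fun y => ?_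
    simp only [hJ, neg_zero, zero_mul, Real.exp_zero, one_mul]
    rw [← integral_indicator measurableSet_Ioi, ← integral_indicator measurableSet_Ioi,
      ← integral_sub_right_eq_self _ y]
    refine integral_congr_ae (Eventually.of_forall fun v => ?_)
    simp [Set.indicator]
  have hE1 : Tendsto E atTop (𝓝 0) := by
    have h0 : Tendsto E atTop (𝓝 (∑' _ : ℕ, (0 : ℝ))) := by
      refine tendsto_tsum_of_dominated_convergence
        (bound := fun n => Pᶜ.indicator f n / n * C) (hP.mul_right C) (fun n => ?_)
        (Eventually.of_forall fun y n => ?_)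
      · have h2 : Tendsto (fun y : ℝ => l * (Real.log n - y)) atTop (cocompact ℝ) := by
          refine (Tendsto.const_mul_atBot hl0 ?_).mono_right atBot_le_cocompact
          exact tendsto_atBot_add_const_left _ _ tendsto_neg_atTop_atBot
        simpa using ((hHlim.comp h2).abs).const_mul (Pᶜ.indicator f n / n)
      · have := Set.indicator_nonneg (s := Pᶜ) (fun n _ => hf n) n
        rw [Real.norm_eq_abs, abs_mul, abs_abs, abs_of_nonneg (by positivity)]
        gcongr
        exact hC _
    simpa using h0
  have hfin : Tendsto (fun y => (R 1 y).re + c * J 0 y - E y) atTop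
      (𝓝 ((0 : ℂ).re + c * (l⁻¹ * ∫ u, H u) - 0)) :=
    (((Complex.continuous_re.tendsto _).comp hR1).add (hJ1.const_mul c)).sub hE1
  have hpos : 0 < (0 : ℂ).re + c * (l⁻¹ * ∫ u, H u) - 0 := by
    simp only [Complex.zero_re, zero_add, sub_zero]
    positivity
  filter_upwards [hfin.eventually (lt_mem_nhds hpos)] with y hy
  by_contra h
  linarith [hbound y h]

lemma eventually_exists_prime_modEq_one (g : ℕ) [NeZero g] {r : ℝ} (hr0 : 0 < r) (hr1 : r < 1) :
    ∀ᶠ x : ℝ in atTop, ∃ p : ℕ, p.Prime ∧ (p : ZMod g) = 1 ∧ r * x ≤ p ∧ p ≤ x := by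
  open ArithmeticFunction.vonMangoldt in
  have key : ∀ᶠ y : ℝ in atTop, ∃ p ∈ {p : ℕ | p.Prime ∧ (p : ZMod g) = 1},
      |Real.log p - y| < -Real.log r / 2 := by
    refine eventually_exists_mem_of_LSeries (f := residueClass (1 : ZMod g))
      (residueClass_nonneg 1) (fun s hs => ?_) (continuousOn_LFunctionResidueClassAux (1 : ZMod g))
      (c := (g.totient : ℝ)⁻¹) ?_ (fun s hs => ?_) ?_ ?_
    · refine LSeriesSummable_of_abscissaOfAbsConv_lt_re ?_
      exact (abscissaOfAbsConv_residueClass_le_one 1).trans_lt (by exact_mod_cast hs)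
    · have := Nat.totient_pos.2 (Nat.pos_of_neZero g)
      positivity
    · rw [eqOn_LFunctionResidueClassAux isUnit_one hs]
      push_cast
      ring
    · refine (summable_residueClass_non_primes_div (1 : ZMod g)).congr fun n => ?_
      by_cases hn : n.Prime <;> by_cases hn1 : (n : ZMod g) = 1 <;>
        simp [hn, hn1]
    · have := Real.log_neg hr0 hr1
      linarith
  have hlim : Tendsto (fun x : ℝ => Real.log x + Real.log r / 2) atTop atTop :=
    tendsto_atTop_add_const_right _ _ Real.tendsto_log_atTop
  filter_upwards [hlim.eventually key, eventually_gt_atTop 0] with x ⟨p, ⟨hp, hp1⟩, hpx⟩ hx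
  have hp0 : (0 : ℝ) < p := by exact_mod_cast hp.pos
  obtain ⟨h1, h2⟩ := abs_lt.1 hpx
  refine ⟨p, hp, hp1, ?_, ?_⟩
  · rw [← Real.log_le_log_iff (by positivity) hp0, Real.log_mul hr0.ne' hx.ne']
    linarith
  · rw [← Real.log_le_log_iff hp0 hx]
    linarith

lemma bddAbove_card (g n : ℕ) : BddAbove {k | ∃ A : Finset ℤ, A ⊆ Finset.Icc (1 : ℤ) (n : ℤ) ∧
    A.card = k ∧ ∀ x : ℤ, x ≠ 0 → ((A ×ˢ A).filter (fun p => p.1 - p.2 = x)).card ≤ g} := by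
  refine ⟨n, ?_⟩
  rintro k ⟨A, hA, rfl, -⟩
  simpa using Finset.card_le_card hA

lemma card_le_alpha {g n : ℕ} {A : Finset ℤ} (hA : A ⊆ Finset.Icc (1 : ℤ) (n : ℤ))
    (h : ∀ x : ℤ, x ≠ 0 → ((A ×ˢ A).filter (fun p => p.1 - p.2 = x)).card ≤ g) :
    A.card ≤ alpha g n :=
  le_csSup (bddAbove_card g n) ⟨A, hA, rfl, h⟩

lemma exists_card_eq_alpha (g n : ℕ) : ∃ A : Finset ℤ, A ⊆ Finset.Icc (1 : ℤ) (n : ℤ) ∧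
    A.card = alpha g n ∧
    ∀ x : ℤ, x ≠ 0 → ((A ×ˢ A).filter (fun p => p.1 - p.2 = x)).card ≤ g := by
  refine Nat.sSup_mem (s := {k | ∃ A : Finset ℤ, A ⊆ Finset.Icc (1 : ℤ) (n : ℤ) ∧ A.card = k ∧
    ∀ x : ℤ, x ≠ 0 → ((A ×ˢ A).filter (fun p => p.1 - p.2 = x)).card ≤ g}) ?_ (bddAbove_card g n)
  exact ⟨0, ∅, by simp⟩

/-- Counting pairs of elements of `A` in windows of length `u` (Erdős–Turán). -/
lemma sq_card_le {g n : ℕ} {A : Finset ℤ} (hA : A ⊆ Finset.Icc (1 : ℤ) (n : ℤ))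
    (h : ∀ x : ℤ, x ≠ 0 → ((A ×ˢ A).filter (fun p => p.1 - p.2 = x)).card ≤ g) (u : ℕ) :
    (u * A.card) ^ 2 ≤ (n + u) * (g * u ^ 2 + u * A.card) := by
  classical
  set W : Finset (ℤ × ℕ) := A ×ˢ Finset.range u with hW
  set T : Finset ℤ := Finset.Icc 1 ((n : ℤ) + u) with hT
  set N : ℤ → ℕ := fun t => (W.filter fun w => w.1 + w.2 = t).card with hN
  have hmap : ∀ w ∈ W, w.1 + (w.2 : ℤ) ∈ T := by
    intro w hw
    obtain ⟨h1, h2⟩ := Finset.mem_product.1 hw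
    have := Finset.mem_Icc.1 (hA h1)
    have := Finset.mem_range.1 h2
    exact Finset.mem_Icc.2 ⟨by omega, by omega⟩
  have h1 : u * A.card = ∑ t ∈ T, N t := by
    rw [← Finset.card_eq_sum_card_fiberwise (f := fun w : ℤ × ℕ => w.1 + (w.2 : ℤ)) hmap, hW,
      Finset.card_product, Finset.card_range, mul_comm]
  have h2 : (∑ t ∈ T, N t) ^ 2 ≤ T.card * ∑ t ∈ T, N t ^ 2 := sq_sum_le_card_mul_sum_sq
  have hTc : T.card = n + u := by
    rw [hT, Int.card_Icc]
    omega
  have h3 : ∑ t ∈ T, N t ^ 2 = ((W ×ˢ W).filter fun q =>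
      q.1.1 + (q.1.2 : ℤ) = q.2.1 + (q.2.2 : ℤ)).card := by
    rw [Finset.card_eq_sum_card_fiberwise (f := fun q : (ℤ × ℕ) × (ℤ × ℕ) => q.1.1 + (q.1.2 : ℤ))
      (t := T)]
    · refine Finset.sum_congr rfl fun t _ => ?_
      rw [sq, hN, ← Finset.card_product]
      congr 1
      ext ⟨⟨a, i⟩, ⟨b, j⟩⟩
      simp only [Finset.mem_product, Finset.mem_filter]
      constructor
      · rintro ⟨⟨h1, h2⟩, h3, h4⟩
        exact ⟨⟨⟨h1, h3⟩, by omega⟩, h2⟩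
      · rintro ⟨⟨⟨h1, h3⟩, h4⟩, h2⟩
        exact ⟨⟨h1, h2⟩, h3, by omega⟩
    · intro q hq
      exact hmap _ (Finset.mem_product.1 (Finset.mem_filter.1 hq).1).1
  have h4 : ((W ×ˢ W).filter fun q =>
      q.1.1 + (q.1.2 : ℤ) = q.2.1 + (q.2.2 : ℤ)).card ≤ g * u ^ 2 + u * A.card := by
    set U := Finset.range u ×ˢ Finset.range u with hU
    have hm : ∀ q ∈ (W ×ˢ W).filter fun q => q.1.1 + (q.1.2 : ℤ) = q.2.1 + (q.2.2 : ℤ),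
        (q.1.2, q.2.2) ∈ U := by
      rintro ⟨⟨a, i⟩, ⟨b, j⟩⟩ hq
      simp only [hW, Finset.mem_product, Finset.mem_filter] at hq
      simp only [hU, Finset.mem_product]
      exact ⟨hq.1.1.2, hq.1.2.2⟩
    rw [Finset.card_eq_sum_card_fiberwise hm]
    have hb : ∀ ij ∈ U, (((W ×ˢ W).filter fun q =>
        q.1.1 + (q.1.2 : ℤ) = q.2.1 + (q.2.2 : ℤ)).filter fun q => (q.1.2, q.2.2) = ij).card ≤
        g + if ij.1 = ij.2 then A.card else 0 := by
      rintro ⟨i, j⟩ hij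
      have hle : (((W ×ˢ W).filter fun q =>
        q.1.1 + (q.1.2 : ℤ) = q.2.1 + (q.2.2 : ℤ)).filter fun q => (q.1.2, q.2.2) = (i, j)).card ≤
        ((A ×ˢ A).filter fun p => p.1 - p.2 = (j : ℤ) - i).card := by
        refine Finset.card_le_card_of_injOn (fun q => (q.1.1, q.2.1)) ?_ ?_
        · rintro ⟨⟨a, i'⟩, ⟨b, j'⟩⟩ hq
          simp only [hW, Finset.coe_filter, Finset.mem_product, Finset.mem_filter, Prod.mk.injEq,
            Set.mem_ofPred_eq] at hq ⊢
          obtain ⟨⟨⟨⟨h1, h2⟩, h3, h4⟩, h5⟩, rfl, rfl⟩ := hq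
          exact ⟨⟨h1, h3⟩, by omega⟩
        · rintro ⟨⟨a, i'⟩, ⟨b, j'⟩⟩ hq ⟨⟨c, k'⟩, ⟨d, l'⟩⟩ hq' heq
          simp only [Finset.coe_filter, Finset.mem_filter, Prod.mk.injEq,
            Set.mem_ofPred_eq] at hq hq' heq ⊢
          obtain ⟨-, rfl, rfl⟩ := hq
          obtain ⟨-, rfl, rfl⟩ := hq'
          exact ⟨⟨heq.1, rfl⟩, heq.2, rfl⟩
      refine hle.trans ?_
      by_cases hd : i = j
      · subst hd
        simp only [sub_self, if_true]
        have : ((A ×ˢ A).filter fun p => p.1 - p.2 = (0 : ℤ)).card ≤ A.card := by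
          refine Finset.card_le_card_of_injOn Prod.fst ?_ ?_
          · intro p hp
            simp only [Finset.coe_filter, Finset.mem_product, Set.mem_ofPred_eq] at hp
            exact hp.1.1
          · rintro ⟨a, b⟩ hp ⟨c, d⟩ hp' heq
            simp only [Finset.coe_filter, Finset.mem_product, Set.mem_ofPred_eq] at hp hp' heq
            ext <;> simp only <;> omega
        omega
      · have := h ((j : ℤ) - i) (by omega)
        simp only [hd, if_false]
        omega
    refine (Finset.sum_le_sum hb).trans ?_
    rw [Finset.sum_add_distrib, Finset.sum_const, hU, Finset.sum_product]
    simp only [Finset.sum_ite_eq, Finset.card_product, Finset.card_range, smul_eq_mul]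
    have : ∑ x ∈ Finset.range u, (if x ∈ Finset.range u then A.card else 0) = u * A.card := by
      rw [Finset.sum_congr rfl fun x hx => if_pos hx]
      simp
    rw [this]
    linarith [mul_comm g (u ^ 2), sq u, mul_comm g (u * u)]
  rw [h1, ← hTc]
  refine h2.trans (Nat.mul_le_mul_left _ ?_)
  rw [h3, ← h1]
  exact h4

lemma alpha_mono (g : ℕ) : Monotone (alpha g) := by
  intro m n hmn
  obtain ⟨A, hA, hAc, h⟩ := exists_card_eq_alpha g m
  rw [← hAc]
  exact card_le_alpha (hA.trans (Finset.Icc_subset_Icc_right (by exact_mod_cast hmn))) h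

/-- Ruzsa's construction. -/
lemma sub_one_le_alpha {g M p : ℕ} [Fact p.Prime] (hM : g * M = p - 1) :
    p - 1 ≤ alpha g (M * p) := by
  classical
  have hp : p.Prime := Fact.out
  have hp2 := hp.two_le
  have hM0 : M ≠ 0 := by
    rintro rfl
    omega
  have hg0 : g ≠ 0 := by
    rintro rfl
    omega
  have hMp : M < p := by
    have : M ≤ g * M := Nat.le_mul_of_pos_left M (Nat.pos_of_ne_zero hg0)
    omega
  have hco : M.Coprime p := (Nat.coprime_of_lt_prime hM0 hMp hp).symm
  obtain ⟨γ, hγ⟩ := IsCyclic.exists_generator (α := (ZMod p)ˣ)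
  have hord : orderOf γ = p - 1 := by
    rw [orderOf_eq_card_of_forall_mem_zpowers hγ, Nat.card_eq_fintype_card, ZMod.card_units]
  set a : ℕ → ℕ := fun x => Nat.chineseRemainder hco x ((γ ^ x : (ZMod p)ˣ) : ZMod p).val with ha
  have haM : ∀ x : ℕ, (M : ℤ) ∣ (x : ℤ) - a x := fun x =>
    Nat.modEq_iff_dvd.1 (Nat.chineseRemainder hco x ((γ ^ x : (ZMod p)ˣ) : ZMod p).val).2.1
  have hap : ∀ x, ((a x : ℕ) : ZMod p) = ((γ ^ x : (ZMod p)ˣ) : ZMod p) := by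
    intro x
    have := (Nat.chineseRemainder hco x ((γ ^ x : (ZMod p)ˣ) : ZMod p).val).2.2
    rw [← ZMod.natCast_eq_natCast_iff] at this
    rw [ha, this, ZMod.natCast_zmod_val]
  have halt : ∀ x, a x < M * p := fun x => Nat.chineseRemainder_lt_mul hco _ _ hM0 hp.ne_zero
  have hpow : ∀ x ∈ Finset.range (p - 1), ∀ y ∈ Finset.range (p - 1), γ ^ x = γ ^ y → x = y := by
    intro x hx y hy hxy
    refine pow_injOn_Iio_orderOf ?_ ?_ hxy
    · rw [hord]
      exact Finset.mem_range.1 hx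
    · rw [hord]
      exact Finset.mem_range.1 hy
  set A : Finset ℤ := (Finset.range (p - 1)).image fun x => (a x : ℤ) + 1 with hA
  have hcard : A.card = p - 1 := by
    rw [hA, Finset.card_image_of_injOn, Finset.card_range]
    intro x hx y hy hxy
    have h1 : a x = a y := by
      simp only at hxy
      omega
    refine hpow x hx y hy (Units.ext ?_)
    rw [← hap, ← hap, h1]
  rw [← hcard]
  refine card_le_alpha ?_ ?_
  · intro b hb
    obtain ⟨x, -, rfl⟩ := Finset.mem_image.1 hb
    have := halt x
    refine Finset.mem_Icc.2 ⟨by omega, ?_⟩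
    exact_mod_cast this
  intro d hd
  set z : ZMod p := ((γ ^ ((g : ℤ) * d) : (ZMod p)ˣ) : ZMod p) with hz
  have hroots : (Polynomial.nthRoots g z).toFinset.card ≤ g :=
    (Multiset.toFinset_card_le _).trans (Polynomial.card_nthRoots g z)
  have hsub : ∀ x y : ℕ, (a x : ℤ) - a y = d →
      ((γ ^ x : (ZMod p)ˣ) : ZMod p) - ((γ ^ y : (ZMod p)ˣ) : ZMod p) = (d : ZMod p) := by
    intro x y hxy
    rw [← hap, ← hap, ← hxy]
    push_cast
    rfl
  have hd0 : ∀ x ∈ Finset.range (p - 1), ∀ y ∈ Finset.range (p - 1),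
      (a x : ℤ) - a y = d → (d : ZMod p) ≠ 0 := by
    intro x hx y hy hxy h0
    have h1 := hsub x y hxy
    rw [h0, sub_eq_zero] at h1
    have := hpow x hx y hy (Units.ext h1)
    subst this
    exact hd (by rw [← hxy, sub_self])
  refine le_trans (Finset.card_le_card_of_injOn
    (fun q : ℤ × ℤ => ((q.1 - 1 : ℤ) : ZMod p) / ((q.2 - 1 : ℤ) : ZMod p)) ?_ ?_) hroots
  · rintro ⟨b, c⟩ hq
    simp only [hA, Finset.coe_filter, Finset.mem_product, Finset.mem_image,
      Set.mem_ofPred_eq] at hq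
    obtain ⟨⟨⟨x, hx, rfl⟩, ⟨y, hy, rfl⟩⟩, hxy⟩ := hq
    rw [add_sub_add_right_eq_sub] at hxy
    simp only [add_sub_cancel_right, Int.cast_natCast, hap, Finset.mem_coe, Multiset.mem_toFinset]
    rw [Polynomial.mem_nthRoots (Nat.pos_of_ne_zero hg0), hz, ← Units.val_div_eq_div_val,
      ← Units.val_pow_eq_pow_val]
    congr 1
    rw [← zpow_natCast, ← zpow_natCast, ← zpow_natCast, div_eq_mul_inv, ← zpow_sub, ← zpow_mul,
      zpow_eq_zpow_iff_modEq, hord, Int.modEq_iff_dvd, ← hM]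
    have h1 : (M : ℤ) ∣ d - (x - y) := by
      rw [show d - (x - y) = (y - a y) - (x - a x) by linarith]
      exact dvd_sub (haM y) (haM x)
    push_cast
    rw [show (g : ℤ) * d - (x - y) * g = g * (d - (x - y)) by ring]
    exact mul_dvd_mul_left _ h1
  · rintro ⟨b, c⟩ hq ⟨b', c'⟩ hq' heq
    simp only [hA, Finset.coe_filter, Finset.mem_product, Finset.mem_image,
      Set.mem_ofPred_eq] at hq hq'
    obtain ⟨⟨⟨x, hx, rfl⟩, ⟨y, hy, rfl⟩⟩, hxy⟩ := hq
    obtain ⟨⟨⟨x', hx', rfl⟩, ⟨y', hy', rfl⟩⟩, hxy'⟩ := hq'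
    rw [add_sub_add_right_eq_sub] at hxy hxy'
    simp only [add_sub_cancel_right, Int.cast_natCast, hap] at heq
    have e1 := hsub x y hxy
    have e2 := hsub x' y' hxy'
    have hdz := hd0 x hx y hy hxy
    have hy0 : ((γ ^ y : (ZMod p)ˣ) : ZMod p) ≠ 0 := Units.ne_zero _
    have hy0' : ((γ ^ y' : (ZMod p)ˣ) : ZMod p) ≠ 0 := Units.ne_zero _
    rw [div_eq_div_iff hy0 hy0'] at heq
    have e3 : (d : ZMod p) * ((γ ^ y' : (ZMod p)ˣ) : ZMod p) =
        d * ((γ ^ y : (ZMod p)ˣ) : ZMod p) := by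
      linear_combination heq - ((γ ^ y' : (ZMod p)ˣ) : ZMod p) * e1 +
        ((γ ^ y : (ZMod p)ˣ) : ZMod p) * e2
    have hyy := hpow y' hy' y hy (Units.ext (mul_left_cancel₀ hdz e3))
    subst hyy
    exact Prod.ext (by simp only; omega) rfl

lemma tendsto_sqrt_mul_atTop {g : ℕ} (hg : 0 < g) :
    Tendsto (fun n : ℕ => Real.sqrt (g * n)) atTop atTop := by
  refine Real.tendsto_sqrt_atTop.comp (tendsto_natCast_atTop_atTop.const_mul_atTop ?_)
  exact_mod_cast hg

lemma eventually_alpha_le {g : ℕ} (hg : 0 < g) {δ : ℝ} (hδ : 0 < δ) (hδ1 : δ ≤ 1) :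
    ∀ᶠ n : ℕ in atTop, (alpha g n : ℝ) ≤ (1 + 5 * δ) * Real.sqrt (g * n) := by
  have hlim := tendsto_sqrt_mul_atTop hg
  have hlim' : Tendsto (fun n : ℕ => δ * (n : ℝ)) atTop atTop :=
    tendsto_natCast_atTop_atTop.const_mul_atTop hδ
  filter_upwards [hlim.eventually_ge_atTop (1 / δ ^ 2), hlim'.eventually_ge_atTop 1,
    hlim.eventually_gt_atTop 0] with n hn1 hn2 hs0
  obtain ⟨A, hA, hAc, h⟩ := exists_card_eq_alpha g n
  have key := sq_card_le hA h ⌈δ * n⌉₊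
  rw [hAc] at key
  set u := ⌈δ * (n : ℝ)⌉₊
  have hu1 : δ * n ≤ u := Nat.le_ceil _
  have hu2 : (u : ℝ) ≤ 2 * δ * n := by
    have := Nat.ceil_lt_add_one (show 0 ≤ δ * (n : ℝ) by positivity)
    linarith
  have key' : ((u : ℝ) * alpha g n) ^ 2 ≤ (n + u) * (g * u ^ 2 + u * alpha g n) := by
    exact_mod_cast key
  set s := Real.sqrt (g * n) with hs
  have hss : s ^ 2 = g * n := Real.sq_sqrt (by positivity)
  have hu0 : (0 : ℝ) < u := by linarith
  generalize (alpha g n : ℝ) = k at *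
  by_contra! hk
  have hks : s ≤ k := by nlinarith
  have hk0 : 0 < k := hs0.trans_le hks
  have hg' : (0 : ℝ) < g := by exact_mod_cast hg
  have hn0 : (0 : ℝ) < n := by
    by_contra! h0
    nlinarith
  have hδs : 1 ≤ δ ^ 2 * s := by
    rwa [div_le_iff₀' (by positivity)] at hn1
  have h1 : k ^ 2 * u ≤ (n + u) * (g * u + k) := by
    refine le_of_mul_le_mul_right ?_ hu0
    linarith
  have h2 : s * k ≤ g * δ * u * k := by
    refine mul_le_mul_of_nonneg_right ?_ hk0.le
    calc s ≤ δ ^ 2 * s * s := le_mul_of_one_le_left hs0.le hδs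
      _ = g * δ * (δ * n) := by linear_combination δ ^ 2 * hss
      _ ≤ g * δ * u := by gcongr
  have h3 : s * (g * u + k) ≤ g * u * k * (1 + δ) := by
    have : g * u * s ≤ g * u * k := by gcongr
    linarith
  have h4 : s * (k ^ 2 * u) ≤ (1 + 2 * δ) * n * (g * u * k * (1 + δ)) := by
    calc s * (k ^ 2 * u) ≤ s * ((n + u) * (g * u + k)) := by gcongr
      _ = (n + u) * (s * (g * u + k)) := by ring
      _ ≤ (1 + 2 * δ) * n * (g * u * k * (1 + δ)) := by
        gcongr
        linarith
  have h5 : k ≤ (1 + 2 * δ) * (1 + δ) * s := by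
    refine le_of_mul_le_mul_right ?_ (show 0 < s * k * u by positivity)
    calc k * (s * k * u) = s * (k ^ 2 * u) := by ring
      _ ≤ _ := h4
      _ = (1 + 2 * δ) * (1 + δ) * (g * n) * (k * u) := by ring
      _ = _ := by rw [← hss]; ring
  have h6 : (1 + 2 * δ) * (1 + δ) * s ≤ (1 + 5 * δ) * s := by
    gcongr
    nlinarith
  linarith

lemma eventually_le_alpha {g : ℕ} (hg : 0 < g) {r : ℝ} (hr0 : 0 < r) (hr1 : r < 1) :
    ∀ᶠ n : ℕ in atTop, r * Real.sqrt (g * n) - 1 ≤ alpha g n := by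
  have : NeZero g := ⟨hg.ne'⟩
  filter_upwards [(tendsto_sqrt_mul_atTop hg).eventually
    (eventually_exists_prime_modEq_one g hr0 hr1)] with n ⟨p, hp, hpg, hp1, hp2⟩
  have : Fact p.Prime := ⟨hp⟩
  obtain ⟨M, hM⟩ : g ∣ p - 1 := by
    rw [← ZMod.natCast_eq_zero_iff, Nat.cast_sub hp.one_le, hpg, Nat.cast_one, sub_self]
  have hpn : p * p ≤ g * n := by
    have h1 : (p : ℝ) ^ 2 ≤ g * n := (Real.le_sqrt' (by exact_mod_cast hp.pos)).1 hp2
    rw [sq] at h1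
    exact_mod_cast h1
  have hMn : M * p ≤ n := by
    refine Nat.le_of_mul_le_mul_left ?_ hg
    calc g * (M * p) = (p - 1) * p := by rw [hM, mul_assoc]
      _ ≤ p * p := Nat.mul_le_mul_right _ (Nat.sub_le _ _)
      _ ≤ g * n := hpn
  have h2 : p - 1 ≤ alpha g n := (sub_one_le_alpha hM.symm).trans (alpha_mono g hMn)
  have h3 : (p : ℝ) ≤ alpha g n + 1 := by exact_mod_cast (show p ≤ alpha g n + 1 by omega)
  linarith

theorem stmt15 (g : ℕ) (hg : 0 < g) :
    Filter.Tendsto (fun n : ℕ => (alpha g n : ℝ) / Real.sqrt (g * n))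
      Filter.atTop (nhds 1) := by
  have hlim := tendsto_sqrt_mul_atTop hg
  refine tendsto_order.2 ⟨fun a ha => ?_, fun a ha => ?_⟩
  · obtain ⟨r, hr, hr1⟩ := exists_between (max_lt ha zero_lt_one)
    obtain ⟨har, hr0⟩ := max_lt_iff.1 hr
    filter_upwards [eventually_le_alpha hg hr0 hr1, hlim.eventually_gt_atTop 0,
      hlim.eventually_gt_atTop (1 / (r - a))] with n h1 h2 h3
    rw [div_lt_iff₀' (by linarith)] at h3
    rw [lt_div_iff₀ h2]
    linarith
  · obtain ⟨δ, hδ0, hδ⟩ := exists_between (lt_min (show 0 < (a - 1) / 5 by linarith) zero_lt_one)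
    obtain ⟨hδa, hδ1⟩ := lt_min_iff.1 hδ
    filter_upwards [eventually_alpha_le hg hδ0 hδ1.le, hlim.eventually_gt_atTop 0] with n h1 h2
    rw [div_lt_iff₀ h2]
    exact h1.trans_lt (mul_lt_mul_of_pos_right (by linarith) h2)
end

section
/- Let g and n be positive integers and let A ⊆ {1, …, n} be a set of cardinality k such that for every nonzero integer x there are at most g ordered pairs (a₁, a₂) ∈ A × A with a₁ − a₂ = x. Let ℓ be a positive integer with ℓ ≤ (k − 1)/2 and set s = kℓ − ℓ(ℓ+1)/2. If s > g, then k < √(gn)·√(1 + 1/ℓ) + (ℓ + 1)/2 + g/ℓ. -/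
/-- If at most `g` members of a family of positive integers share any given value, then the sum of
the family is at least `T * #P - g * T * (T - 1) / 2` for every natural number `T`. -/
theorem threshold_le_two_mul_sum {ι : Type*} (P : Finset ι) (f : ι → ℤ) (g : ℕ)
    (hpos : ∀ p ∈ P, 1 ≤ f p) (hfib : ∀ x : ℤ, x ≠ 0 → (P.filter (fun p => f p = x)).card ≤ g)
    (T : ℕ) : 2 * (T : ℤ) * P.card - g * (T * (T - 1)) ≤ 2 * ∑ p ∈ P, f p := by
  have hsmall : ∀ T : ℕ, (P.filter (fun p => f p ≤ T)).card ≤ g * T := by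
    intro T
    have h := Finset.card_le_mul_card_image_of_maps_to (s := P.filter (fun p => f p ≤ T))
      (t := Finset.Icc (1 : ℤ) T) (f := f)
      (by
        intro p hp
        rw [Finset.mem_filter] at hp
        exact Finset.mem_Icc.2 ⟨hpos p hp.1, hp.2⟩) g
      (by
        intro x hx
        have hx1 := (Finset.mem_Icc.1 hx).1
        refine le_trans (Finset.card_le_card ?_) (hfib x (by omega))
        intro p hp
        simp only [Finset.mem_filter] at hp ⊢
        exact ⟨hp.1.1, hp.2⟩)
    simpa using h
  have key : ∀ T : ℕ, 2 * (T : ℤ) * P.card - g * (T * (T - 1)) ≤ 2 * ∑ p ∈ P, min (f p) T := by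
    intro T
    induction T with
    | zero =>
      have : 0 ≤ ∑ p ∈ P, min (f p) ((0 : ℕ) : ℤ) :=
        Finset.sum_nonneg fun p hp => by have := hpos p hp; simp; omega
      simpa using this
    | succ T ih =>
      have hstep : ∑ p ∈ P, min (f p) ((T + 1 : ℕ) : ℤ)
          = ∑ p ∈ P, min (f p) T + (P.card - (P.filter (fun p => f p ≤ T)).card) := by
        have h1 : ∀ p ∈ P, min (f p) ((T + 1 : ℕ) : ℤ)
            = min (f p) T + (1 - if f p ≤ T then 1 else 0) := by
          intro p _
          split_ifs <;> push_cast <;> omega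
        rw [Finset.sum_congr rfl h1, Finset.sum_add_distrib, Finset.sum_sub_distrib]
        simp
      have h2 : ((P.filter (fun p => f p ≤ T)).card : ℤ) ≤ g * T := by exact_mod_cast hsmall T
      rw [hstep]
      push_cast
      nlinarith
  refine (key T).trans ?_
  gcongr
  exact min_le_left _ _

/-- If at most `g` members of a family of positive integers share any given value, then the sum of
the family is at least `#P ^ 2 / (2 * g)`. -/
theorem card_sq_le_two_mul_sum {ι : Type*} (P : Finset ι) (f : ι → ℤ) (g : ℕ) (hg : 0 < g)
    (hpos : ∀ p ∈ P, 1 ≤ f p)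
    (hfib : ∀ x : ℤ, x ≠ 0 → (P.filter (fun p => f p = x)).card ≤ g) :
    (P.card : ℤ) ^ 2 ≤ g * (2 * ∑ p ∈ P, f p) := by
  have h := threshold_le_two_mul_sum P f g hpos hfib (P.card / g + 1)
  have hdiv : (P.card : ℤ) = g * ((P.card / g : ℕ) : ℤ) + ((P.card % g : ℕ) : ℤ) := by
    exact_mod_cast (Nat.div_add_mod P.card g).symm
  have hr : ((P.card % g : ℕ) : ℤ) < g := by exact_mod_cast Nat.mod_lt _ hg
  generalize ((P.card % g : ℕ) : ℤ) = r at hdiv hr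
  push_cast at h
  have h0 : (0 : ℤ) ≤ r := by
    have h3 := Nat.div_mul_le_self P.card g
    have h4 : (((P.card / g : ℕ) : ℤ)) * g ≤ P.card := by exact_mod_cast h3
    linarith
  have hq : (0 : ℤ) ≤ ((P.card / g : ℕ) : ℤ) := by positivity
  push_cast at hq hdiv
  generalize (P.card : ℤ) / (g : ℤ) = q at *
  have hg' : (0 : ℤ) ≤ g := by positivity
  have h5 := mul_le_mul_of_nonneg_left h hg'
  refine le_trans ?_ h5
  rw [hdiv]
  nlinarith [mul_nonneg (mul_nonneg hg' hg') hq, mul_nonneg h0 (sub_nonneg.2 hr.le),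
    mul_nonneg h0 hg']

theorem two_mul_sum_range_sub_succ (k ℓ : ℕ) (h : ℓ ≤ k) :
    2 * ((∑ d ∈ Finset.range ℓ, (k - (d + 1)) : ℕ) : ℤ) = 2 * k * ℓ - ℓ * (ℓ + 1) := by
  induction ℓ with
  | zero => simp
  | succ ℓ ih =>
    have := ih (by omega)
    rw [Finset.sum_range_succ, Nat.cast_add, Nat.cast_sub h, mul_add, this]
    push_cast
    ring

theorem sum_range_shift_sub_le (a : ℕ → ℤ) (n k d : ℕ) (hd : d ≤ k)
    (ha : ∀ i < k, 1 ≤ a i ∧ a i ≤ n) :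
    ∑ i ∈ Finset.range (k - d), (a (i + d) - a i) ≤ d * n := by
  have h1 := Finset.sum_range_add a (k - d) d
  have h2 := Finset.sum_range_add a d (k - d)
  rw [Nat.sub_add_cancel hd] at h1
  rw [Nat.add_sub_cancel' hd] at h2
  have h3 : ∑ i ∈ Finset.range d, a (k - d + i) ≤ ∑ _i ∈ Finset.range d, (n : ℤ) :=
    Finset.sum_le_sum fun i hi => (ha _ (by have := Finset.mem_range.1 hi; omega)).2
  have h4 : 0 ≤ ∑ i ∈ Finset.range d, a i :=
    Finset.sum_nonneg fun i hi => by
      have := (ha i (by have := Finset.mem_range.1 hi; omega)).1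
      omega
  simp only [Finset.sum_const, Finset.card_range, nsmul_eq_mul] at h3
  rw [Finset.sum_sub_distrib]
  simp only [add_comm _ d]
  linarith

theorem sq_card_short_differences_le (g n k ℓ : ℕ) (hg : 0 < g)
    (A : Finset ℤ) (hA : A ⊆ Finset.Icc (1 : ℤ) (n : ℤ)) (hcard : A.card = k)
    (hbound : ∀ x : ℤ, x ≠ 0 →
      ((A ×ˢ A).filter (fun p => p.1 - p.2 = x)).card ≤ g) (hk : ℓ ≤ k) :
    ((∑ d ∈ Finset.range ℓ, (k - (d + 1)) : ℕ) : ℤ) ^ 2 ≤ g * (n * (ℓ * (ℓ + 1))) := by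
  obtain ⟨a, hmem, hmono⟩ : ∃ a : ℕ → ℤ, (∀ i < k, a i ∈ A) ∧
      ∀ i j, i < j → j < k → a i < a j := by
    refine ⟨fun i => if h : i < k then A.orderEmbOfFin hcard ⟨i, h⟩ else 0, ?_, ?_⟩
    · intro i hi
      simp [hi, Finset.orderEmbOfFin_mem]
    · intro i j hij hj
      simp [hj, hij.trans hj, hij]
  have hinj : ∀ i j, i < k → j < k → a i = a j → i = j := by
    intro i j hi hj h
    rcases lt_trichotomy i j with hij | hij | hij
    · exact absurd h (hmono i j hij hj).ne
    · exact hij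
    · exact absurd h (hmono j i hij hi).ne'
  let P : Finset (Σ _ : ℕ, ℕ) := (Finset.range ℓ).sigma fun d => Finset.range (k - (d + 1))
  have hP : ∀ p ∈ P, p.2 + (p.1 + 1) < k := by
    intro p hp
    have := (Finset.mem_sigma.1 hp).2
    rw [Finset.mem_range] at this
    omega
  have hsq := card_sq_le_two_mul_sum P (fun p => a (p.2 + (p.1 + 1)) - a p.2) g hg
    (by
      intro p hp
      have := hmono p.2 (p.2 + (p.1 + 1)) (by omega) (hP p hp)
      omega)
    (by
      intro x hx
      refine le_trans (Finset.card_le_card_of_injOn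
        (fun p => (a (p.2 + (p.1 + 1)), a p.2)) ?_ ?_) (hbound x hx)
      · intro p hp
        have hp' := Finset.mem_filter.1 hp
        have := hP p hp'.1
        simp only [Finset.coe_filter, Finset.mem_product, Set.mem_ofPred_eq]
        exact ⟨⟨hmem _ this, hmem _ (by omega)⟩, hp'.2⟩
      · intro p hp q hq hpq
        have hp' := hP p (Finset.mem_filter.1 hp).1
        have hq' := hP q (Finset.mem_filter.1 hq).1
        rw [Prod.mk.injEq] at hpq
        have h1 := hinj _ _ hp' hq' hpq.1
        have h2 := hinj _ _ (by omega) (by omega) hpq.2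
        obtain ⟨p1, p2⟩ := p
        obtain ⟨q1, q2⟩ := q
        simp only at h1 h2
        obtain rfl : p1 = q1 := by omega
        rw [h2])
  rw [Finset.card_sigma, Finset.sum_sigma] at hsq
  simp only [Finset.card_range] at hsq
  refine hsq.trans (mul_le_mul_of_nonneg_left ?_ (by positivity))
  have hup : ∑ d ∈ Finset.range ℓ, ∑ i ∈ Finset.range (k - (d + 1)), (a (i + (d + 1)) - a i)
      ≤ ∑ d ∈ Finset.range ℓ, ((d + 1 : ℕ) : ℤ) * n :=
    Finset.sum_le_sum fun d hd => sum_range_shift_sub_le a n k (d + 1)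
      (by have := Finset.mem_range.1 hd; omega) fun i hi => Finset.mem_Icc.1 (hA (hmem i hi))
  have hgauss : ∀ m : ℕ, 2 * ∑ d ∈ Finset.range m, ((d + 1 : ℕ) : ℤ) * n = n * (m * (m + 1)) := by
    intro m
    induction m with
    | zero => simp
    | succ m ih =>
      rw [Finset.sum_range_succ, mul_add, ih]
      push_cast
      ring
  linarith [hgauss ℓ]

theorem stmt17 (g n k ℓ : ℕ) (hg : 0 < g) (hn : 0 < n)
    (A : Finset ℤ) (hA : A ⊆ Finset.Icc (1 : ℤ) (n : ℤ)) (hcard : A.card = k)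
    (hbound : ∀ x : ℤ, x ≠ 0 →
      ((A ×ˢ A).filter (fun p => p.1 - p.2 = x)).card ≤ g)
    (hl : 0 < ℓ) (hl2 : (ℓ : ℝ) ≤ ((k : ℝ) - 1) / 2)
    (s : ℝ) (hs : s = (k : ℝ) * ℓ - ℓ * (ℓ + 1) / 2)
    (hsg : (g : ℝ) < s) :
    (k : ℝ) < Real.sqrt (g * n) * Real.sqrt (1 + 1 / ℓ) + ((ℓ : ℝ) + 1) / 2 + g / ℓ := by
  have hk : ℓ ≤ k := by
    have h0 : (0 : ℝ) ≤ ℓ := by positivity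
    have : (ℓ : ℝ) ≤ k := by linarith
    exact_mod_cast this
  have hsq := sq_card_short_differences_le g n k ℓ hg A hA hcard hbound hk
  have hcount := two_mul_sum_range_sub_succ k ℓ hk
  generalize (∑ d ∈ Finset.range ℓ, (k - (d + 1)) : ℕ) = c at hsq hcount
  have hcount' : 2 * (c : ℝ) = 2 * k * ℓ - ℓ * (ℓ + 1) := by exact_mod_cast hcount
  have hsq' : (c : ℝ) ^ 2 ≤ g * (n * (ℓ * (ℓ + 1))) := by exact_mod_cast hsq
  have hl' : (0 : ℝ) < ℓ := by exact_mod_cast hl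
  have hu : (k : ℝ) - (ℓ + 1) / 2 = c / ℓ := by
    field_simp
    linarith
  have hle : (k : ℝ) - (ℓ + 1) / 2 ≤ Real.sqrt (g * n) * Real.sqrt (1 + 1 / ℓ) := by
    rw [← Real.sqrt_mul (by positivity), hu]
    apply Real.le_sqrt_of_sq_le
    rw [div_pow, div_le_iff₀ (by positivity)]
    refine hsq'.trans (le_of_eq ?_)
    field_simp
  have hpos : (0 : ℝ) < g / ℓ := by positivity
  linarith
end

section
/- Let g be a fixed positive integer. For every ε > 0 and all sufficiently large n, there exists a set A ⊆ {1, …, n} with |A| ≥ (1 − ε)·√(gn) such that for every nonzero integer x there are at most g ordered pairs (a₁, a₂) ∈ A × A with a₁ − a₂ = x. -/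
open MeasureTheory FourierTransform Real Filter Topology
open Complex (I)
open scoped Complex

/-- A continuous even function supported on `[-π, π]`. -/
noncomputable def sineBump (t : ℝ) : ℝ :=
  if |t| ≤ π then 3 * sin |t| + (π - |t|) * cos |t| else 0

lemma continuous_sineBump : Continuous sineBump := by
  refine Continuous.if_le (by fun_prop) continuous_const (by fun_prop) continuous_const ?_
  intro x hx
  simp [hx]

lemma hasCompactSupport_sineBump : HasCompactSupport sineBump := by
  refine HasCompactSupport.intro (isCompact_Icc (a := -π) (b := π)) fun x hx => ?_
  have : ¬ |x| ≤ π := fun h => hx (abs_le.mp h)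
  simp [sineBump, this]

lemma integrable_sineBump : Integrable sineBump :=
  continuous_sineBump.integrable_of_hasCompactSupport hasCompactSupport_sineBump

lemma integral_sin_bump_mul_cos (u : ℝ) :
    (1 - u ^ 2) ^ 2 * ∫ x in (0 : ℝ)..π, (3 * sin x + (π - x) * cos x) * cos (u * x) =
      2 * (1 + cos (u * π)) * (2 - u ^ 2) := by
  have hd : ∀ x : ℝ, HasDerivAt (fun x : ℝ =>
      -(4 - 2 * u ^ 2) * (cos x * cos (u * x) + u * (sin x * sin (u * x))) -
        (1 - u ^ 2) * (-((π - x) * sin x) * cos (u * x) +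
          u * ((sin x + (π - x) * cos x) * sin (u * x))))
      ((1 - u ^ 2) ^ 2 * ((3 * sin x + (π - x) * cos x) * cos (u * x))) x := by
    intro x
    have hs := hasDerivAt_sin x
    have hc := hasDerivAt_cos x
    have hl : HasDerivAt (fun x : ℝ => u * x) u x := by
      simpa using (hasDerivAt_id x).const_mul u
    have hp : HasDerivAt (fun x : ℝ => π - x) (-1) x := by
      simpa using (hasDerivAt_id x).const_sub π
    have hsu := hl.sin
    have hcu := hl.cos
    have := (((hc.mul hcu).add ((hs.mul hsu).const_mul u)).const_mul (-(4 - 2 * u ^ 2))).sub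
      (((((hp.mul hs).neg).mul hcu).add
        (((hs.add (hp.mul hc)).mul hsu).const_mul u)).const_mul (1 - u ^ 2))
    refine (this.congr_deriv ?_)
    simp only [Pi.mul_apply, Pi.neg_apply, Pi.add_apply]
    ring
  rw [← intervalIntegral.integral_const_mul, intervalIntegral.integral_eq_sub_of_hasDerivAt
    (fun x _ => hd x) (Continuous.intervalIntegrable (by fun_prop) _ _)]
  simp
  ring

lemma fourier_sineBump (u : ℝ) :
    𝓕 (fun t => (sineBump t : ℂ)) u =
      ((2 * ∫ x in (0 : ℝ)..π, (3 * sin x + (π - x) * cos x) * cos (2 * π * u * x) : ℝ) : ℂ) := by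
  have h1 : ∀ v : ℝ, Complex.exp (((-2 * π * v * u : ℝ) : ℂ) * Complex.I) • (sineBump v : ℂ) =
      ((sineBump v * cos (2 * π * u * v) : ℝ) : ℂ) -
        ((sineBump v * sin (2 * π * u * v) : ℝ) : ℂ) * Complex.I := by
    intro v
    rw [Complex.exp_mul_I, ← Complex.ofReal_cos, ← Complex.ofReal_sin,
      show -2 * π * v * u = -(2 * π * u * v) by ring, cos_neg, sin_neg]
    push_cast
    simp only [smul_eq_mul]
    ring
  have hcos : Integrable fun v => sineBump v * cos (2 * π * u * v) :=
    (continuous_sineBump.mul (by fun_prop)).integrable_of_hasCompactSupport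
      hasCompactSupport_sineBump.mul_right
  have hsin : Integrable fun v => sineBump v * sin (2 * π * u * v) :=
    (continuous_sineBump.mul (by fun_prop)).integrable_of_hasCompactSupport
      hasCompactSupport_sineBump.mul_right
  have hodd : ∫ v, sineBump v * sin (2 * π * u * v) = 0 := by
    have := integral_neg_eq_self (fun v => sineBump v * sin (2 * π * u * v)) volume
    have h2 : ∀ v, sineBump (-v) * sin (2 * π * u * -v) =
        -(sineBump v * sin (2 * π * u * v)) := by
      intro v
      simp [sineBump]
    simp_rw [h2, integral_neg] at this
    linarith
  have heven : ∫ v, sineBump v * cos (2 * π * u * v) =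
      2 * ∫ x in (0 : ℝ)..π, (3 * sin x + (π - x) * cos x) * cos (2 * π * u * x) := by
    have h3 : ∀ v, sineBump v * cos (2 * π * u * v) =
        (fun x => sineBump x * cos (2 * π * u * x)) |v| := by
      intro v
      rcases abs_choice v with h | h <;> simp [sineBump, h]
    rw [integral_congr_ae (ae_of_all _ h3),
      integral_comp_abs (f := fun x => sineBump x * cos (2 * π * u * x)),
      intervalIntegral.integral_of_le pi_pos.le]
    congr 1
    rw [setIntegral_eq_of_subset_of_forall_sdiff_eq_zero (s := Set.Ioc 0 π) measurableSet_Ioi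
      Set.Ioc_subset_Ioi_self]
    · refine setIntegral_congr_fun measurableSet_Ioc fun x hx => ?_
      simp [sineBump, abs_of_pos hx.1, hx.2]
    · intro x hx
      have h0 : 0 < x := hx.1
      have : ¬ x ≤ π := fun h => hx.2 ⟨h0, h⟩
      simp [sineBump, abs_of_pos h0, this]
  rw [fourier_real_eq_integral_exp_smul]
  simp_rw [h1]
  rw [integral_sub hcos.ofReal (hsin.ofReal.mul_const _), integral_mul_const,
    integral_complex_ofReal, integral_complex_ofReal, hodd, heven]
  simp

lemma fourier_sineBump_formula (u : ℝ) :
    (1 - (2 * π * u) ^ 2) ^ 2 * (𝓕 (fun t => (sineBump t : ℂ)) u).re =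
      4 * (1 + cos (2 * π * u * π)) * (2 - (2 * π * u) ^ 2) := by
  rw [fourier_sineBump, Complex.ofReal_re]
  linear_combination 2 * integral_sin_bump_mul_cos (2 * π * u)

lemma fourier_sineBump_re_nonpos {u : ℝ} (hu : 1 ≤ |u|) :
    (𝓕 (fun t => (sineBump t : ℂ)) u).re ≤ 0 := by
  have h := fourier_sineBump_formula u
  have hu2 : 1 ≤ u ^ 2 := (one_le_sq_iff_one_le_abs u).mpr hu
  have hv : 4 ≤ (2 * π * u) ^ 2 := by
    have : 1 ≤ π ^ 2 := by nlinarith [pi_gt_three]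
    nlinarith
  have hc := neg_one_le_cos (2 * π * u * π)
  by_contra! hpos
  nlinarith [mul_pos (show 0 < (1 - (2 * π * u) ^ 2) ^ 2 by nlinarith) hpos,
    mul_nonneg (show 0 ≤ 1 + cos (2 * π * u * π) by linarith)
      (show 0 ≤ (2 * π * u) ^ 2 - 2 by linarith)]

lemma integrable_fourier_sineBump : Integrable (𝓕 (fun t => (sineBump t : ℂ))) := by
  set M := ∫ v, ‖(sineBump v : ℂ)‖
  have hM : ∀ u, ‖𝓕 (fun t => (sineBump t : ℂ)) u‖ ≤ M := fun u =>
    VectorFourier.norm_fourierIntegral_le_integral_norm _ _ _ _ _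
  have hM0 : 0 ≤ M := (norm_nonneg _).trans (hM 0)
  have hcont : Continuous (𝓕 (fun t => (sineBump t : ℂ))) :=
    VectorFourier.fourierIntegral_continuous continuous_fourierChar
      (by fun_prop) integrable_sineBump.ofReal
  refine (integrable_inv_one_add_sq.const_mul (8 + 2 * M)).mono' hcont.aestronglyMeasurable
    (Filter.Eventually.of_forall fun u => ?_)
  rw [← div_eq_mul_inv, le_div_iff₀ (by positivity)]
  rcases le_or_gt 1 |u| with hu | hu
  · have hre := fourier_sineBump_re_nonpos hu
    have h := fourier_sineBump_formula u
    have hn : ‖𝓕 (fun t => (sineBump t : ℂ)) u‖ = -(𝓕 (fun t => (sineBump t : ℂ)) u).re := by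
      rw [← abs_of_nonpos hre, fourier_sineBump, Complex.norm_real, Complex.ofReal_re,
        norm_eq_abs]
    rw [hn]
    set F := (𝓕 (fun t => (sineBump t : ℂ)) u).re
    have hu2 : 1 ≤ u ^ 2 := (one_le_sq_iff_one_le_abs u).mpr hu
    have hpi : 9 ≤ π ^ 2 := by nlinarith [pi_gt_three]
    have hv : 36 * u ^ 2 ≤ (2 * π * u) ^ 2 := by nlinarith
    have hc := cos_le_one (2 * π * u * π)
    set v := (2 * π * u) ^ 2
    have h1 : (v - 1) * (-F) ≤ 8 := by
      have : (v - 1) * ((v - 1) * (-F)) ≤ (v - 1) * 8 := by nlinarith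
      exact le_of_mul_le_mul_left this (by linarith)
    nlinarith
  · have hu2 : u ^ 2 < 1 := (sq_lt_one_iff_abs_lt_one u).mpr hu
    nlinarith [hM u, norm_nonneg (𝓕 (fun t => (sineBump t : ℂ)) u)]

/-- A band-limited integrable function of positive integral whose real part is nonpositive
outside a given neighbourhood of the origin. -/
theorem exists_fourier_re_nonpos {δ : ℝ} (hδ : 0 < δ) :
    ∃ w : ℝ → ℂ, Continuous w ∧ HasCompactSupport w ∧ 0 < (w 0).re ∧ Integrable (𝓕 w) ∧
      ∀ u, δ ≤ |u| → (𝓕 w u).re ≤ 0 := by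
  have hF : ∀ u, 𝓕 (fun t => (sineBump (δ * t) : ℂ)) u =
      (δ⁻¹ : ℝ) • 𝓕 (fun t => (sineBump t : ℂ)) (δ⁻¹ * u) := by
    intro u
    simp_rw [fourier_real_eq_integral_exp_smul]
    have := Measure.integral_comp_mul_left (fun v : ℝ =>
      Complex.exp (((-2 * π * v * (δ⁻¹ * u) : ℝ) : ℂ) * Complex.I) • (sineBump v : ℂ)) δ
    rw [abs_of_pos (inv_pos.mpr hδ)] at this
    rw [← this]
    congr 1 with v
    rw [show -2 * π * (δ * v) * (δ⁻¹ * u) = -2 * π * v * u by field_simp]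
  refine ⟨fun t => (sineBump (δ * t) : ℂ), ?_, ?_, ?_, ?_, fun u hu => ?_⟩
  · exact Complex.continuous_ofReal.comp (continuous_sineBump.comp (by fun_prop))
  · refine HasCompactSupport.intro (isCompact_Icc (a := -(π / δ)) (b := π / δ)) fun x hx => ?_
    have : ¬ |δ * x| ≤ π := fun h => hx <| by
      rw [abs_mul, abs_of_pos hδ, mul_comm, ← le_div_iff₀ hδ] at h
      exact abs_le.mp h
    simp only [sineBump, if_neg this, Complex.ofReal_zero]
  · simp [sineBump, pi_pos.le, pi_pos]
  · rw [funext hF]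
    exact (integrable_fourier_sineBump.comp_mul_left' (inv_pos.mpr hδ).ne').smul (δ⁻¹ : ℝ)
  · rw [hF, Complex.real_smul, Complex.re_ofReal_mul]
    refine mul_nonpos_of_nonneg_of_nonpos (inv_pos.mpr hδ).le (fourier_sineBump_re_nonpos ?_)
    rw [abs_mul, abs_of_pos (inv_pos.mpr hδ), inv_mul_eq_div]
    exact (one_le_div hδ).mpr hu

lemma continuous_fourier {w : ℝ → ℂ} (hw : Integrable w) : Continuous (𝓕 w) :=
  VectorFourier.fourierIntegral_continuous continuous_fourierChar (by fun_prop) hw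

/-- Integrating an absolutely convergent Dirichlet series on a vertical line against
`w` smooths its coefficients by the Fourier transform of `w`. -/
lemma hasSum_term_mul_fourier {f : ℕ → ℂ} {σ : ℝ} (hf : LSeriesSummable f σ) {w : ℝ → ℂ}
    (hw : Continuous w) (hc : HasCompactSupport w) (y : ℝ) :
    HasSum (fun n => LSeries.term f σ n * 𝓕 w (y - log n))
      (∫ t : ℝ, cexp (((-2 * π * t * y : ℝ) : ℂ) * I) * w t * LSeries f (σ - 2 * π * t * I)) := by
  have hterm : ∀ (n : ℕ) (t : ℝ), LSeries.term f (σ - 2 * π * t * I) n =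
      LSeries.term f σ n * cexp (((2 * π * t * log n : ℝ) : ℂ) * I) := by
    intro n t
    rcases eq_or_ne n 0 with rfl | hn
    · simp
    · have hn' : (n : ℂ) ≠ 0 := by exact_mod_cast hn
      rw [LSeries.term_of_ne_zero hn, LSeries.term_of_ne_zero hn, Complex.cpow_sub _ _ hn',
        Complex.cpow_def_of_ne_zero hn' (2 * π * t * I), ← Complex.natCast_log,
        show (log n : ℂ) * (2 * π * t * I) = ((2 * π * t * log n : ℝ) : ℂ) * I by
          push_cast; ring, div_div_eq_mul_div, div_mul_eq_mul_div]
  let F : ℕ → ℝ → ℂ := fun n t => LSeries.term f σ n *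
    (cexp (((-2 * π * t * (y - log n) : ℝ) : ℂ) * I) * w t)
  have hFn : ∀ n t, ‖F n t‖ = ‖LSeries.term f σ n‖ * ‖w t‖ := by
    intro n t
    simp only [F, norm_mul, Complex.norm_exp_ofReal_mul_I, one_mul]
  have hFi : ∀ n, Integrable (F n) := fun n =>
    ((Continuous.mul (by fun_prop) hw).integrable_of_hasCompactSupport hc.mul_left).const_mul _
  have hs : Summable fun n => ∫ t, ‖F n t‖ := by
    simp_rw [hFn, integral_const_mul]
    exact hf.norm.mul_right _
  have key := hasSum_integral_of_summable_integral_norm hFi hs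
  have hl : (fun n => LSeries.term f σ n * 𝓕 w (y - log n)) = fun n => ∫ t, F n t := by
    funext n
    simp only [F, smul_eq_mul, fourier_real_eq_integral_exp_smul, ← integral_const_mul]
  have hr : ∀ t : ℝ, cexp (((-2 * π * t * y : ℝ) : ℂ) * I) * w t *
      LSeries f (σ - 2 * π * t * I) = ∑' n, F n t := by
    intro t
    rw [LSeries, ← tsum_mul_left]
    congr 1 with n
    rw [hterm]
    simp only [F]
    rw [show ((-2 * π * t * (y - log n) : ℝ) : ℂ) * I =
      ((-2 * π * t * y : ℝ) : ℂ) * I + ((2 * π * t * log n : ℝ) : ℂ) * I by push_cast; ring,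
      Complex.exp_add]
    ring
  simp_rw [hl, hr]
  exact key

lemma integral_div_eq_integral_exp_mul_fourier {w : ℝ → ℂ} (hw : Continuous w)
    (hc : HasCompactSupport w) (y : ℝ) {η : ℝ} (hη : 0 < η) :
    ∫ t : ℝ, cexp (((-2 * π * t * y : ℝ) : ℂ) * I) * w t / (η - 2 * π * t * I) =
      ∫ v in Set.Ioi (0 : ℝ), (rexp (-η * v) : ℂ) * 𝓕 w (y - v) := by
  let F : ℝ → ℝ → ℂ := fun t v =>
    cexp (((-2 * π * t * y : ℝ) : ℂ) * I) * w t * cexp ((-η + 2 * π * t * I) * v)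
  have hFn : ∀ p : ℝ × ℝ, ‖Function.uncurry F p‖ = ‖w p.1‖ * rexp (-η * p.2) := by
    intro p
    simp [F, Function.uncurry, Complex.norm_exp]
  have hFint : Integrable (Function.uncurry F) (volume.prod (volume.restrict (Set.Ioi 0))) := by
    have hwi : Integrable w := hw.integrable_of_hasCompactSupport hc
    have h := hwi.norm.mul_prod
      (integrableOn_exp_mul_Ioi (neg_lt_zero.mpr hη) 0)
    refine h.mono' (Continuous.aestronglyMeasurable ?_) (ae_of_all _ fun p => (hFn p).le)
    simp only [F, Function.uncurry_def]
    fun_prop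
  have hsw := integral_integral_swap hFint
  convert hsw using 1
  · congr 1 with t
    simp only [F]
    rw [integral_const_mul, integral_exp_mul_complex_Ioi (by simpa using hη)]
    rw [show (-η + 2 * π * t * I : ℂ) = -(η - 2 * π * t * I) by ring]
    simp only [Complex.ofReal_zero, mul_zero, Complex.exp_zero, neg_div_neg_eq, mul_one_div]
  · congr 1 with v
    rw [fourier_real_eq_integral_exp_smul, ← integral_const_mul]
    congr 1 with t
    simp only [F, smul_eq_mul]
    rw [show ((-2 * π * t * (y - v) : ℝ) : ℂ) * I =
      ((-2 * π * t * y : ℝ) : ℂ) * I + ((2 * π * t * v : ℝ) : ℂ) * I by push_cast; ring,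
      show (-η + 2 * π * t * I : ℂ) * v = ((-η * v : ℝ) : ℂ) + ((2 * π * t * v : ℝ) : ℂ) * I by
        push_cast; ring, Complex.exp_add, Complex.exp_add, Complex.ofReal_exp]
    ring

lemma tendsto_integral_mul_boundary {G : ℂ → ℂ} (hG : ContinuousOn G {s | 1 ≤ s.re})
    {w : ℝ → ℂ} (hw : Continuous w) (hc : HasCompactSupport w) (y : ℝ) :
    Tendsto (fun η : ℝ => ∫ t : ℝ, cexp (((-2 * π * t * y : ℝ) : ℂ) * I) * w t *
        G ((1 + η : ℝ) - 2 * π * t * I)) (𝓝[>] 0)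
      (𝓝 (∫ t : ℝ, cexp (((-2 * π * t * y : ℝ) : ℂ) * I) * w t * G (1 - 2 * π * t * I))) := by
  let φ : ℝ × ℝ → ℂ := fun p => ((1 + p.1 : ℝ) : ℂ) - 2 * π * p.2 * I
  have hφ : Continuous φ := by fun_prop
  have hφre : ∀ p, (φ p).re = 1 + p.1 := by intro p; simp [φ]
  have hcomp : ∀ η : ℝ, 0 ≤ η → Continuous fun t : ℝ => G (φ (η, t)) := by
    intro η hη
    refine hG.comp_continuous (by fun_prop) fun t => ?_
    simpa [hφre] using hη
  have hK : IsCompact (Set.Icc (0 : ℝ) 1 ×ˢ tsupport w) := isCompact_Icc.prod hc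
  obtain ⟨C, hC⟩ := hK.exists_bound_of_continuousOn (f := fun p => G (φ p))
    (hG.comp hφ.continuousOn fun p hp => by simpa [hφre] using hp.1.1)
  have hmem : ∀ᶠ η : ℝ in 𝓝[>] 0, η ∈ Set.Ioc (0 : ℝ) 1 := Ioc_mem_nhdsGT one_pos
  refine tendsto_integral_filter_of_dominated_convergence (fun t => ‖w t‖ * C) ?_ ?_ ?_ ?_
  · filter_upwards [hmem] with η hη
    exact Continuous.aestronglyMeasurable (((by fun_prop : Continuous fun t : ℝ =>
      cexp (((-2 * π * t * y : ℝ) : ℂ) * I)).mul hw).mul (hcomp η hη.1.le))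
  · filter_upwards [hmem] with η hη
    refine ae_of_all _ fun t => ?_
    rw [norm_mul, norm_mul, Complex.norm_exp_ofReal_mul_I, one_mul]
    by_cases ht : t ∈ tsupport w
    · exact mul_le_mul_of_nonneg_left (hC (η, t) ⟨⟨hη.1.le, hη.2⟩, ht⟩) (norm_nonneg _)
    · simp [image_eq_zero_of_notMem_tsupport ht]
  · exact (hw.integrable_of_hasCompactSupport hc).norm.mul_const _
  · refine ae_of_all _ fun t => Tendsto.const_mul _ ?_
    have h1 : ContinuousWithinAt G {s | 1 ≤ s.re} (φ (0, t)) := hG _ (by simp [hφre])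
    have h2 : Tendsto (fun η : ℝ => φ (η, t)) (𝓝[>] 0) (𝓝[{s | 1 ≤ s.re}] (φ (0, t))) := by
      refine tendsto_nhdsWithin_iff.mpr ⟨?_, ?_⟩
      · exact ((by fun_prop : Continuous fun η : ℝ => φ (η, t)).tendsto 0).mono_left
          nhdsWithin_le_nhds
      · filter_upwards [hmem] with η hη
        simpa [hφre] using hη.1.le
    simpa [φ, Function.comp_def] using h1.tendsto.comp h2

lemma tendsto_integral_exp_mul_sub {F : ℝ → ℂ} (hF : Integrable F) (y : ℝ) :
    Tendsto (fun η : ℝ => ∫ v in Set.Ioi (0 : ℝ), (rexp (-η * v) : ℂ) * F (y - v)) (𝓝[>] 0)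
      (𝓝 (∫ v in Set.Iio y, F v)) := by
  have hFy : Integrable fun v => F (y - v) := hF.comp_sub_left y
  have heq : ∫ v in Set.Iio y, F v = ∫ v in Set.Ioi (0 : ℝ), F (y - v) := by
    rw [← integral_indicator measurableSet_Iio, ← integral_indicator measurableSet_Ioi,
      ← integral_sub_left_eq_self _ volume y]
    congr 1 with v
    simp [Set.indicator_apply]
  rw [heq]
  refine tendsto_integral_filter_of_dominated_convergence (fun v => ‖F (y - v)‖) ?_ ?_ ?_ ?_
  · refine Eventually.of_forall fun η => AEStronglyMeasurable.mul ?_ hFy.1.restrict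
    exact Continuous.aestronglyMeasurable (by fun_prop)
  · filter_upwards [self_mem_nhdsWithin] with η hη
    refine (ae_restrict_iff' measurableSet_Ioi).mpr (ae_of_all _ fun v hv => ?_)
    have hη' : 0 < η := hη
    have hv' : 0 < v := hv
    rw [norm_mul, Complex.norm_real, norm_eq_abs, abs_of_pos (exp_pos _)]
    refine mul_le_of_le_one_left (norm_nonneg _) (exp_le_one_iff.mpr ?_)
    nlinarith [mul_pos hη' hv']
  · exact hFy.norm.integrableOn
  · refine ae_of_all _ fun v => ?_
    have : Tendsto (fun η : ℝ => (rexp (-η * v) : ℂ) * F (y - v)) (𝓝 0)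
        (𝓝 ((rexp (-0 * v) : ℂ) * F (y - v))) :=
      (by fun_prop : Continuous fun η : ℝ => (rexp (-η * v) : ℂ) * F (y - v)).tendsto 0
    simpa using this.mono_left nhdsWithin_le_nhds

/-- A Tauberian theorem of Wiener–Ikehara type for short intervals: if the Dirichlet series of
the nonnegative sequence `f` has a simple pole at `1` and is otherwise continuous on `1 ≤ re s`,
then `f` is nonzero somewhere in every multiplicatively short interval far enough out. -/
theorem eventually_exists_ne_zero_abs_sub_log_lt {f : ℕ → ℝ} (hf : ∀ n, 0 ≤ f n) {c : ℝ}
    (hc : 0 < c) {G : ℂ → ℂ} (hG : ContinuousOn G {s | 1 ≤ s.re})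
    (hsum : ∀ σ : ℝ, 1 < σ → LSeriesSummable (fun n => (f n : ℂ)) σ)
    (hL : ∀ s : ℂ, 1 < s.re → LSeries (fun n => (f n : ℂ)) s = G s + c / (s - 1))
    {δ : ℝ} (hδ : 0 < δ) :
    ∀ᶠ y : ℝ in atTop, ∃ n : ℕ, f n ≠ 0 ∧ n ≠ 0 ∧ |y - log n| < δ := by
  obtain ⟨w, hw, hwc, hw0, hwF, hneg⟩ := exists_fourier_re_nonpos hδ
  have hwi : Integrable w := hw.integrable_of_hasCompactSupport hwc
  have hinv : ∫ u, 𝓕 w u = w 0 := by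
    have := congrFun (hw.fourierInv_fourier_eq hwi hwF) 0
    rw [fourierInv_eq'] at this
    simpa using this
  have hlim : Tendsto (fun y : ℝ =>
      (∫ t : ℝ, cexp (((-2 * π * t * y : ℝ) : ℂ) * I) * w t * G (1 - 2 * π * t * I)) +
        c * ∫ v in Set.Iio y, 𝓕 w v) atTop (𝓝 (0 + c * w 0)) := by
    refine Tendsto.add ?_ (Tendsto.const_mul _ ?_)
    · have := (zero_at_infty_fourier (fun t : ℝ => w t * G (1 - 2 * π * t * I))).mono_left
        atTop_le_cocompact
      refine this.congr fun y => ?_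
      rw [fourier_real_eq_integral_exp_smul]
      simp only [smul_eq_mul, mul_assoc]
    · rw [← hinv]
      exact (aecover_Iio tendsto_id).integral_tendsto_of_countably_generated hwF
  have hpos : (0 : ℝ) < (0 + c * w 0 : ℂ).re := by
    rw [zero_add, Complex.re_ofReal_mul]
    exact mul_pos hc hw0
  filter_upwards [((Complex.continuous_re.tendsto _).comp hlim).eventually (lt_mem_nhds hpos)]
    with y hy
  by_contra! hno
  refine absurd hy (not_lt.mpr ?_)
  have hlim' := (tendsto_integral_mul_boundary hG hw hwc y).add
    ((tendsto_integral_exp_mul_sub hwF y).const_mul (c : ℂ))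
  refine le_of_tendsto ((Complex.continuous_re.tendsto _).comp hlim') ?_
  filter_upwards [self_mem_nhdsWithin] with η hη
  have hη' : 0 < η := hη
  have hS := hasSum_term_mul_fourier (hsum (1 + η) (by linarith)) hw hwc y
  have hFint : Integrable fun t : ℝ => cexp (((-2 * π * t * y : ℝ) : ℂ) * I) * w t *
      G ((1 + η : ℝ) - 2 * π * t * I) := by
    refine Continuous.integrable_of_hasCompactSupport (Continuous.mul (by fun_prop) ?_)
      hwc.mul_left.mul_right
    refine hG.comp_continuous (by fun_prop) fun t => ?_
    simpa using hη'.le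
  have hne : ∀ t : ℝ, (η - 2 * π * t * I : ℂ) ≠ 0 := fun t h => by
    have := congrArg Complex.re h
    simp at this
    linarith
  have hFint' : Integrable fun t : ℝ =>
      c * (cexp (((-2 * π * t * y : ℝ) : ℂ) * I) * w t / (η - 2 * π * t * I)) := by
    simp_rw [div_eq_mul_inv]
    refine Continuous.integrable_of_hasCompactSupport (continuous_const.mul
      (Continuous.mul (by fun_prop) ?_)) hwc.mul_left.mul_right.mul_left
    exact Continuous.inv₀ (by fun_prop) hne
  have hsplit : ∫ t : ℝ, cexp (((-2 * π * t * y : ℝ) : ℂ) * I) * w t *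
        LSeries (fun n => (f n : ℂ)) ((1 + η : ℝ) - 2 * π * t * I) =
      (∫ t : ℝ, cexp (((-2 * π * t * y : ℝ) : ℂ) * I) * w t *
        G ((1 + η : ℝ) - 2 * π * t * I)) +
      c * ∫ v in Set.Ioi (0 : ℝ), (rexp (-η * v) : ℂ) * 𝓕 w (y - v) := by
    rw [← integral_div_eq_integral_exp_mul_fourier hw hwc y hη', ← integral_const_mul,
      ← integral_add hFint hFint']
    congr 1 with t
    rw [hL _ (by simpa using hη'), show ((1 + η : ℝ) - 2 * π * t * I - 1 : ℂ) =
      η - 2 * π * t * I by push_cast; ring]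
    ring
  rw [hsplit] at hS
  refine ((Complex.hasSum_re hS).nonpos fun n => ?_)
  rcases eq_or_ne n 0 with rfl | hn
  · simp
  by_cases hfn : f n = 0
  · simp [LSeries.term_of_ne_zero hn, hfn]
  have hterm : LSeries.term (fun n => (f n : ℂ)) ((1 + η : ℝ) : ℂ) n =
      ((f n / (n : ℝ) ^ (1 + η) : ℝ) : ℂ) := by
    rw [LSeries.term_of_ne_zero hn]
    push_cast
    rw [Complex.ofReal_cpow n.cast_nonneg]
    push_cast
    rfl
  rw [hterm, Complex.re_ofReal_mul]
  exact mul_nonpos_of_nonneg_of_nonpos (div_nonneg (hf n) (by positivity))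
    (hneg _ (hno n hfn hn))

lemma LSeries_norm_term_le_norm_div (f : ℕ → ℂ) {s : ℂ} (hs : 1 ≤ s.re) (n : ℕ) :
    ‖LSeries.term f s n‖ ≤ ‖f n‖ / n := by
  rcases eq_or_ne n 0 with rfl | hn
  · simp
  · rw [LSeries.norm_term_eq, if_neg hn]
    have h1 : (1 : ℝ) ≤ n := by exact_mod_cast Nat.one_le_iff_ne_zero.mpr hn
    gcongr
    simpa using Real.rpow_le_rpow_of_exponent_le h1 hs

lemma continuousOn_LSeries_of_summable_norm_div {f : ℕ → ℂ}
    (hf : Summable fun n => ‖f n‖ / (n : ℝ)) : ContinuousOn (LSeries f) {s | 1 ≤ s.re} := by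
  refine continuousOn_tsum (fun n => ?_) hf fun n s hs => LSeries_norm_term_le_norm_div f hs n
  rcases eq_or_ne n 0 with rfl | hn
  · simpa using continuousOn_const
  · have hn' : (n : ℂ) ≠ 0 := by exact_mod_cast hn
    simp_rw [LSeries.term_of_ne_zero hn]
    refine Continuous.continuousOn (continuous_const.div ?_ fun s => ?_)
    · exact continuous_id.const_cpow (Or.inl hn')
    · simp [Complex.cpow_eq_zero_iff, hn']

open ArithmeticFunction.vonMangoldt in
/-- Primes in an invertible residue class occur in every multiplicatively short interval
far enough out. -/
theorem eventually_exists_prime_abs_sub_log_lt {q : ℕ} [NeZero q] {a : ZMod q} (ha : IsUnit a)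
    {δ : ℝ} (hδ : 0 < δ) :
    ∀ᶠ y : ℝ in atTop, ∃ p : ℕ, p.Prime ∧ (p : ZMod q) = a ∧ |y - log p| < δ := by
  let f : ℕ → ℝ := fun n => if n.Prime then residueClass a n else 0
  let r : ℕ → ℝ := fun n => if n.Prime then 0 else residueClass a n
  have hr0 : ∀ n, 0 ≤ r n := fun n => by
    simp only [r]; split_ifs; exacts [le_rfl, residueClass_nonneg a n]
  have hf0 : ∀ n, 0 ≤ f n := fun n => by
    simp only [f]; split_ifs; exacts [residueClass_nonneg a n, le_rfl]
  have hr : Summable fun n => ‖(r n : ℂ)‖ / (n : ℝ) := by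
    refine (summable_residueClass_non_primes_div a).congr fun n => ?_
    rw [Complex.norm_real, norm_of_nonneg (hr0 n)]
  have hrs : ∀ s : ℂ, 1 ≤ s.re → LSeriesSummable (fun n => (r n : ℂ)) s := fun s hs =>
    Summable.of_norm_bounded hr fun n => LSeries_norm_term_le_norm_div _ hs n
  have hΛs : ∀ s : ℂ, 1 < s.re → LSeriesSummable (fun n => (residueClass a n : ℂ)) s :=
    fun s hs => LSeriesSummable_of_abscissaOfAbsConv_lt_re <|
      (abscissaOfAbsConv_residueClass_le_one a).trans_lt (by exact_mod_cast hs)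
  have hfr : (fun n => (f n : ℂ)) =
      (fun n => (residueClass a n : ℂ)) - fun n => (r n : ℂ) := by
    funext n
    simp only [f, r, Pi.sub_apply]
    split_ifs <;> simp
  have hfs : ∀ s : ℂ, 1 < s.re → LSeriesSummable (fun n => (f n : ℂ)) s := fun s hs => by
    rw [hfr]
    exact (hΛs s hs).sub (hrs s hs.le)
  have hc : (0 : ℝ) < (q.totient : ℝ)⁻¹ :=
    inv_pos.mpr (by exact_mod_cast Nat.totient_pos.mpr (NeZero.pos q))
  have key := eventually_exists_ne_zero_abs_sub_log_lt hf0 hc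
    (G := fun s => LFunctionResidueClassAux a s - LSeries (fun n => (r n : ℂ)) s)
    ((continuousOn_LFunctionResidueClassAux a).sub
      (continuousOn_LSeries_of_summable_norm_div hr))
    (fun σ hσ => hfs σ (by simpa using hσ))
    (fun s hs => by
      rw [hfr, LSeries_sub (hΛs s hs) (hrs s hs.le), eqOn_LFunctionResidueClassAux ha hs]
      push_cast
      ring) hδ
  filter_upwards [key] with y ⟨n, hn, _, hy⟩
  have hp : n.Prime := by
    by_contra h
    exact hn (if_neg h)
  refine ⟨n, hp, ?_, hy⟩
  by_contra h
  refine hn ?_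
  simp [f, residueClass, h]

/-- Every prime `p = g * k + 1` yields a set of `p - 1` integers in `[1, p * k]` all of whose
nonzero differences have at most `g` representations. -/
theorem exists_finset_card_filter_sub_eq_le {p g k : ℕ} (hp : p.Prime) (hk : p - 1 = g * k) :
    ∃ A : Finset ℤ, A ⊆ Finset.Icc (1 : ℤ) (p * k : ℕ) ∧ A.card = p - 1 ∧
      ∀ x : ℤ, x ≠ 0 → ((A ×ˢ A).filter (fun d => d.1 - d.2 = x)).card ≤ g := by
  classical
  have : Fact p.Prime := ⟨hp⟩
  have hp1 : 0 < p - 1 := by have := hp.two_le; omega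
  have hk0 : 0 < k := Nat.pos_of_ne_zero fun h => by simp [h] at hk; omega
  have hcop : p.Coprime k := (Nat.Prime.coprime_iff_not_dvd hp).mpr fun h => by
    have h1 : p ∣ p - 1 := hk ▸ h.mul_left g
    have := Nat.le_of_dvd hp1 h1
    omega
  have : NeZero (p * k) := ⟨(Nat.mul_pos hp.pos hk0).ne'⟩
  have : NeZero k := ⟨hk0.ne'⟩
  have hcard : Nat.card (ZMod p)ˣ = g * k := by
    rw [Nat.card_eq_fintype_card, ZMod.card_units, hk]
  obtain ⟨ψ, hψ⟩ : ∃ ψ : (ZMod p)ˣ →* Multiplicative (ZMod k), Function.Surjective ψ := by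
    have hdvd : k ∣ Nat.card (ZMod p)ˣ := hcard ▸ dvd_mul_left k g
    refine ⟨(AddMonoidHom.toMultiplicative (ZMod.castHom hdvd (ZMod k)).toAddMonoidHom).comp
      (zmodCyclicMulEquiv (inferInstance : IsCyclic (ZMod p)ˣ)).symm.toMonoidHom, ?_⟩
    refine Function.Surjective.comp (g := AddMonoidHom.toMultiplicative
      (ZMod.castHom hdvd (ZMod k)).toAddMonoidHom) ?_ (MulEquiv.surjective _)
    exact ZMod.castHom_surjective hdvd
  have hker : Nat.card ψ.ker = g := by
    have h := ψ.ker.card_mul_index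
    rw [Subgroup.index_ker, hcard, MonoidHom.range_eq_top.mpr hψ, Subgroup.card_top,
      Nat.card_congr Multiplicative.toAdd, Nat.card_zmod] at h
    exact Nat.eq_of_mul_eq_mul_right hk0 h
  have hfiber : ∀ z, (Finset.univ.filter fun u => ψ u = z).card = g := by
    intro z
    obtain ⟨u₀, hu₀⟩ := hψ z
    rw [← hker, Nat.card_eq_fintype_card, Fintype.card_subtype]
    refine Finset.card_bij' (fun u _ => u₀⁻¹ * u) (fun u _ => u₀ * u) ?_ ?_ ?_ ?_ <;>
      simp +contextual [MonoidHom.mem_ker, hu₀]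
  let e : (ZMod p)ˣ → ZMod (p * k) := fun u =>
    (ZMod.chineseRemainder hcop).symm ((u : ZMod p), (ψ u).toAdd)
  let N : (ZMod p)ˣ → ℤ := fun u => ((e u).val : ℤ) + 1
  have hN : ∀ u v x, N u - N v = x →
      (u : ZMod p) - v = x ∧ (ψ u).toAdd - (ψ v).toAdd = (x : ZMod k) := by
    intro u v x h
    have h1 : e u - e v = (x : ZMod (p * k)) := by
      rw [← h]
      simp [N]
    have h2 := congrArg (ZMod.chineseRemainder hcop) h1
    rw [map_sub, map_intCast] at h2
    simp only [e, RingEquiv.apply_symm_apply] at h2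
    exact ⟨congrArg Prod.fst h2, congrArg Prod.snd h2⟩
  have hinj : Function.Injective N := fun u v h => by
    have := (hN u v 0 (sub_eq_zero.mpr h)).1
    exact Units.ext (by simpa [sub_eq_zero] using this)
  refine ⟨Finset.univ.image N, ?_, ?_, fun x hx => ?_⟩
  · intro z hz
    obtain ⟨u, -, rfl⟩ := Finset.mem_image.mp hz
    have := ZMod.val_lt (e u)
    simp only [N, Finset.mem_Icc]
    omega
  · rw [Finset.card_image_of_injective _ hinj, Finset.card_univ, ZMod.card_units]
  · let S := (Finset.univ : Finset ((ZMod p)ˣ × (ZMod p)ˣ)).filter fun d => N d.1 - N d.2 = x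
    calc _ ≤ (S.image fun d => (N d.1, N d.2)).card := by
          refine Finset.card_le_card fun d hd => ?_
          obtain ⟨hd1, hd2⟩ := Finset.mem_filter.mp hd
          obtain ⟨h1, h2⟩ := Finset.mem_product.mp hd1
          obtain ⟨u, -, hu⟩ := Finset.mem_image.mp h1
          obtain ⟨v, -, hv⟩ := Finset.mem_image.mp h2
          exact Finset.mem_image.mpr ⟨(u, v), by simp [S, hu, hv, hd2], by simp [hu, hv]⟩
      _ ≤ S.card := Finset.card_image_le
      _ ≤ (Finset.univ.filter fun u => ψ u = Multiplicative.ofAdd (x : ZMod k)).card := by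
          refine Finset.card_le_card_of_injOn (fun d => d.1 / d.2) ?_ ?_
          · intro d hd
            have hd' : N d.1 - N d.2 = x := by simpa [S] using hd
            have := (hN _ _ _ hd').2
            simp only [Finset.coe_filter, Finset.mem_univ, true_and, Set.mem_ofPred_eq, map_div]
            rw [← this, ofAdd_sub, ofAdd_toAdd, ofAdd_toAdd]
          · rintro ⟨u, v⟩ hd ⟨u', v'⟩ hd' (h : u / v = u' / v')
            have hd₁ : N u - N v = x := by simpa [S] using hd
            have hd₂ : N u' - N v' = x := by simpa [S] using hd'
            obtain ⟨r, hr⟩ : ∃ r, r = u / v := ⟨_, rfl⟩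
            have hu : u = r * v := by rw [hr, div_mul_cancel]
            have hu' : u' = r * v' := by rw [hr, h, div_mul_cancel]
            have hr1 : (r : ZMod p) - 1 ≠ 0 := fun h0 => by
              have h1 : r = 1 := Units.ext (by simpa [sub_eq_zero] using h0)
              rw [h1, one_mul] at hu
              rw [hu, sub_self] at hd₁
              exact hx hd₁.symm
            have e1 := (hN _ _ _ hd₁).1
            have e2 := (hN _ _ _ hd₂).1
            rw [← e2, hu, hu', Units.val_mul, Units.val_mul] at e1
            have hv : v = v' := Units.ext <| mul_left_cancel₀ hr1 (by linear_combination e1)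
            rw [hu, hu', hv]
      _ = g := hfiber _

theorem stmt18 (g : ℕ) (hg : 0 < g) :
    ∀ ε : ℝ, 0 < ε → ∃ N : ℕ, ∀ n : ℕ, N ≤ n →
      ∃ A : Finset ℤ, A ⊆ Finset.Icc (1 : ℤ) (n : ℤ) ∧
        (1 - ε) * Real.sqrt (g * n) ≤ (A.card : ℝ) ∧
        ∀ x : ℤ, x ≠ 0 → ((A ×ˢ A).filter (fun p => p.1 - p.2 = x)).card ≤ g := by
  intro ε hε
  have : NeZero g := ⟨hg.ne'⟩
  have hg' : (0 : ℝ) < g := by exact_mod_cast hg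
  have hsqrt : Tendsto (fun n : ℕ => √(g * n)) atTop atTop :=
    tendsto_sqrt_atTop.comp (tendsto_natCast_atTop_atTop.const_mul_atTop hg')
  have hlog : Tendsto (fun n : ℕ => log √(g * n) - ε / 4) atTop atTop :=
    tendsto_atTop_add_const_right _ _ (tendsto_log_atTop.comp hsqrt)
  have hprime := eventually_exists_prime_abs_sub_log_lt (q := g) isUnit_one
    (show 0 < ε / 4 by positivity)
  obtain ⟨N, hN⟩ := eventually_atTop.mp
    ((hlog.eventually hprime).and (hsqrt.eventually_ge_atTop (2 / ε)))
  refine ⟨N, fun n hn => ?_⟩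
  obtain ⟨⟨p, hp, hpg, hy⟩, hbig⟩ := hN n hn
  set s := √(g * n) with hs
  have hs0 : 0 < s := lt_of_lt_of_le (by positivity) hbig
  have hp0 : (0 : ℝ) < p := by exact_mod_cast hp.pos
  obtain ⟨hy1, hy2⟩ := abs_lt.mp hy
  have hple : (p : ℝ) ≤ s := (log_le_log_iff hp0 hs0).mp (by linarith)
  have hpge : (1 - ε / 2) * s ≤ p := by
    have h1 : rexp (log s - ε / 2) ≤ p := by
      rw [← le_log_iff_exp_le hp0]
      linarith
    rw [sub_eq_add_neg, exp_add, exp_log hs0] at h1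
    nlinarith [add_one_le_exp (-(ε / 2))]
  obtain ⟨k, hk⟩ : g ∣ p - 1 := by
    rw [← ZMod.natCast_eq_zero_iff, Nat.cast_sub hp.one_le, hpg]
    simp
  obtain ⟨A, hA, hcard, hrep⟩ := exists_finset_card_filter_sub_eq_le hp hk
  have hgk : (p : ℝ) - 1 = g * k := by
    rw [← Nat.cast_one, ← Nat.cast_sub hp.one_le, hk, Nat.cast_mul]
  refine ⟨A, hA.trans (Finset.Icc_subset_Icc le_rfl ?_), ?_, hrep⟩
  · have hss : s ^ 2 = g * n := sq_sqrt (by positivity)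
    have : ((p * k : ℕ) : ℝ) ≤ n := by
      refine le_of_mul_le_mul_left ?_ hg'
      push_cast
      nlinarith
    exact_mod_cast this
  · rw [hcard, hk, Nat.cast_mul, ← hgk]
    have : 1 ≤ ε / 2 * s := by
      rw [div_le_iff₀ hε] at hbig
      linarith
    linarith
end

section
/- Let g be a positive integer and q a prime power with q ≡ 1 (mod g). Let F be the finite field with q² elements, let K = {x ∈ F : x^q = x} be its subfield of order q, and let θ be a generator of the multiplicative group of F (so θ has multiplicative order q² − 1, and θ^a is well-defined for a ∈ ℤ/(q² − 1)ℤ). Define B_q = {a ∈ ℤ/(q² − 1)ℤ : θ^a − θ ∈ K}, and let H be the subgroup of ℤ/(q² − 1)ℤ of order g generated by (q² − 1)/g. Then (B_q − B_q) ∩ H = {0}; that is, if a, b ∈ B_q and a − b ∈ H, then a = b. -/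
theorem stmt19 (g q : ℕ) (hg : 0 < g)
    (hq : ∃ p k : ℕ, p.Prime ∧ 0 < k ∧ q = p ^ k)
    (hmod : q ≡ 1 [MOD g])
    (F : Type*) [Field F] [Fintype F] (hcard : Fintype.card F = q ^ 2)
    (θ : Fˣ) (hθ : ∀ x : Fˣ, x ∈ Subgroup.zpowers θ)
    (B : Set (ZMod (q ^ 2 - 1)))
    (hB : B = {a : ZMod (q ^ 2 - 1) | (θ : F) ^ a.val - (θ : F) ∈ {x : F | x ^ q = x}})
    (H : AddSubgroup (ZMod (q ^ 2 - 1)))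
    (hH : H = AddSubgroup.zmultiples (((q ^ 2 - 1) / g : ℕ) : ZMod (q ^ 2 - 1)))
    (a b : ZMod (q ^ 2 - 1)) (ha : a ∈ B) (hb : b ∈ B) (hab : a - b ∈ H) :
    a = b := by
  obtain ⟨p, k, hp, hk, rfl⟩ := hq
  have : Fact p.Prime := ⟨hp⟩
  have : CharP F p :=
    charP_of_card_eq_prime_pow (f := k * 2) (by rw [hcard, pow_mul])
  have hq2 : 2 ≤ p ^ k := hp.two_le.trans (Nat.le_self_pow hk.ne' p)
  have hord : orderOf θ = (p ^ k) ^ 2 - 1 := by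
    rw [orderOf_eq_card_of_forall_mem_zpowers hθ, Nat.card_units, Nat.card_eq_fintype_card, hcard]
  generalize hqdef : p ^ k = q at *
  have hfrob (x y : F) : (x - y) ^ q = x ^ q - y ^ q := by
    rw [← hqdef, sub_pow_char_pow]
  have hlt : q - 1 < q ^ 2 - 1 := by
    have : q < q ^ 2 := by nlinarith
    omega
  have : NeZero (q ^ 2 - 1) := ⟨by omega⟩
  have hgq : g ∣ q - 1 := (Nat.modEq_iff_dvd' (by omega)).mp hmod.symm
  have hgq2 : g ∣ q ^ 2 - 1 := hgq.trans (by simpa using Nat.sub_dvd_pow_sub_pow q 1 2)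
  have hθq : (θ : F) ^ q ≠ θ := by
    intro h
    have h1 : θ ^ (q - 1) = 1 := by
      apply mul_right_cancel (b := θ)
      rw [← pow_succ, Nat.sub_add_cancel (by omega), one_mul]
      exact Units.ext (by simpa using h)
    have h2 := Nat.le_of_dvd (by omega) (orderOf_dvd_of_pow_eq_one h1)
    omega
  have hmul : ((q - 1 : ℕ) : ZMod (q ^ 2 - 1)) * (a - b) = 0 := by
    rw [hH, AddSubgroup.mem_zmultiples_iff] at hab
    obtain ⟨n, hn⟩ := hab
    obtain ⟨c, hc⟩ := hgq
    have h0 : ((q - 1 : ℕ) : ZMod (q ^ 2 - 1)) * (((q ^ 2 - 1) / g : ℕ) : ZMod (q ^ 2 - 1)) = 0 := by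
      rw [← Nat.cast_mul, ZMod.natCast_eq_zero_iff, hc, mul_right_comm, Nat.mul_div_cancel' hgq2]
      exact dvd_mul_right _ _
    rw [← hn, mul_smul_comm, h0, smul_zero]
  have hpow : θ ^ (a.val * (q - 1)) = θ ^ (b.val * (q - 1)) := by
    rw [pow_eq_pow_iff_modEq, hord, ← ZMod.natCast_eq_natCast_iff]
    push_cast [ZMod.natCast_zmod_val]
    linear_combination hmul
  have hpowF : ((θ : F) ^ a.val) ^ (q - 1) = ((θ : F) ^ b.val) ^ (q - 1) := by
    simpa [pow_mul] using congrArg Units.val hpow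
  rw [hB, Set.mem_ofPred_eq, Set.mem_ofPred_eq, hfrob] at ha hb
  have hsucc (x : F) : x ^ q = x ^ (q - 1) * x := by
    rw [← pow_succ, Nat.sub_add_cancel (by omega)]
  have hzero : ((θ : F) ^ q - θ) * ((θ : F) ^ a.val - (θ : F) ^ b.val) = 0 := by
    have h1 := hsucc ((θ : F) ^ a.val)
    have h2 := hsucc ((θ : F) ^ b.val)
    rw [hpowF] at h1
    linear_combination (θ : F) ^ a.val * (h2 - hb) - (θ : F) ^ b.val * (h1 - ha)
  have heq : (θ : F) ^ a.val = (θ : F) ^ b.val :=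
    sub_eq_zero.mp ((mul_eq_zero.mp hzero).resolve_left (sub_ne_zero.mpr hθq))
  have hval : θ ^ a.val = θ ^ b.val := Units.ext (by simpa using heq)
  rw [pow_eq_pow_iff_modEq, hord, ← ZMod.natCast_eq_natCast_iff] at hval
  simpa using hval
end
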